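/- arXiv:2108.00655 — 15 statements merged into one kernel-verified Lean document; each statement's English description precedes it below -/
import Mathlib

section
/- Let X and Y be real Banach spaces with X finite-dimensional. If there exists a Birkhoff–James orthogonality preserver T : X → Y, then Y is finite-dimensional and dim X = dim Y. -/
/-- Birkhoff–James orthogonality: `x ⊥_BJ y` iff `‖x + λ y‖ ≥ ‖x‖` for all `λ : ℝ`. -/
def BJOrth {X : Type*} [NormedAddCommGroup X] [NormedSpace ℝ X] (x y : X) : Prop :=
  ∀ l : ℝ, ‖x‖ ≤ ‖x + l • y‖

theorem BJOrth.fderiv_norm_eq_zero {X : Type*} [NormedAddCommGroup X] [NormedSpace ℝ X]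
    {x y : X} (h : BJOrth x y) (hx : DifferentiableAt ℝ (fun z : X => ‖z‖) x) :
    fderiv ℝ (fun z : X => ‖z‖) x y = 0 := by
  have hd : HasDerivAt (fun l : ℝ => ‖x + l • y‖) (fderiv ℝ (fun z : X => ‖z‖) x y) 0 :=
    hx.hasFDerivAt.hasLineDerivAt y
  have hmin : IsLocalMin (fun l : ℝ => ‖x + l • y‖) 0 :=
    Filter.Eventually.of_forall fun l => by simpa using h l
  exact hmin.hasDerivAt_eq_zero hd

theorem bjOrth_of_apply_eq_zero {X : Type*} [NormedAddCommGroup X] [NormedSpace ℝ X]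
    {x y : X} {f : StrongDual ℝ X} (hf : ‖f‖ ≤ 1) (hx : f x = ‖x‖) (hy : f y = 0) :
    BJOrth x y := fun l =>
  calc ‖x‖ = f (x + l • y) := by simp [hx, hy]
    _ ≤ ‖f (x + l • y)‖ := le_abs_self _
    _ ≤ 1 * ‖x + l • y‖ := f.le_of_opNorm_le hf _
    _ = ‖x + l • y‖ := one_mul _

theorem bjOrth_self_iff {X : Type*} [NormedAddCommGroup X] [NormedSpace ℝ X] {x : X} :
    BJOrth x x ↔ x = 0 := by
  refine ⟨fun h => ?_, fun h l => by simp [h]⟩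
  simpa using h (-1)

/-- A vector killed by the derivative of the norm at every point of differentiability is zero. -/
theorem eq_zero_of_forall_fderiv_norm_eq_zero {X : Type*} [NormedAddCommGroup X]
    [NormedSpace ℝ X] [FiniteDimensional ℝ X] {y : X}
    (h : ∀ x : X, DifferentiableAt ℝ (fun z : X => ‖z‖) x →
      fderiv ℝ (fun z : X => ‖z‖) x y = 0) : y = 0 := by
  by_contra hy
  obtain ⟨x, hx, hxy⟩ := dense_differentiableAt_norm.exists_dist_lt y
    (half_pos (norm_pos_iff.2 hy))
  rw [dist_comm, dist_eq_norm] at hxy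
  have hself : fderiv ℝ (fun z : X => ‖z‖) x x = ‖x‖ := DifferentiableAt.fderiv_norm_self hx
  have hle : ‖x‖ ≤ ‖x - y‖ :=
    calc ‖x‖ = fderiv ℝ (fun z : X => ‖z‖) x (x - y) := by rw [map_sub, h x hx, hself, sub_zero]
      _ ≤ ‖fderiv ℝ (fun z : X => ‖z‖) x (x - y)‖ := le_abs_self _
      _ ≤ 1 * ‖x - y‖ := ContinuousLinearMap.le_of_opNorm_le _
        (by simpa using norm_fderiv_le_of_lipschitz ℝ (lipschitzWith_one_norm (E := X))) _
      _ = ‖x - y‖ := one_mul _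
  linarith [norm_sub_norm_le y x, norm_sub_rev x y]

/-- Some set of at most `dim X` vectors has no nonzero common right-orthogonal vector. -/
theorem exists_finset_bjOrth_eq_zero (X : Type*) [NormedAddCommGroup X] [NormedSpace ℝ X]
    [FiniteDimensional ℝ X] :
    ∃ s : Finset X, s.card ≤ Module.finrank ℝ X ∧ ∀ y, (∀ x ∈ s, BJOrth x y) → y = 0 := by
  classical
  let D : Set X := {x | DifferentiableAt ℝ (fun z : X => ‖z‖) x}
  let g : X → Module.Dual ℝ X := fun x => (fderiv ℝ (fun z : X => ‖z‖) x : X →ₗ[ℝ] ℝ)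
  obtain ⟨b, hbD, hspan, hli⟩ := exists_linearIndependent ℝ (g '' D)
  have hfin : b.Finite := hli.setFinite
  have hbD' : ∀ f : Module.Dual ℝ X, f ∈ b → ∃ x, x ∈ D ∧ g x = f := fun f hf => hbD hf
  choose! r hrD hgr using hbD'
  refine ⟨hfin.toFinset.image r, ?_, fun y hy => ?_⟩
  · have := hfin.fintype
    calc (hfin.toFinset.image r).card ≤ hfin.toFinset.card := Finset.card_image_le
      _ = Fintype.card b := by rw [← Set.toFinset_card]; congr 1; ext; simp
      _ ≤ Module.finrank ℝ (Module.Dual ℝ X) := hli.fintype_card_le_finrank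
      _ = Module.finrank ℝ X := Subspace.dual_finrank_eq
  · have hb : b ⊆ LinearMap.ker (Module.Dual.eval ℝ X y) := fun f hf => by
      have := (hy (r f) (Finset.mem_image_of_mem r (hfin.mem_toFinset.2 hf))).fderiv_norm_eq_zero
        (hrD f hf)
      rw [SetLike.mem_coe, LinearMap.mem_ker, Module.Dual.eval_apply, ← hgr f hf]
      exact this
    have hker := Submodule.span_le.2 hb
    rw [hspan] at hker
    exact eq_zero_of_forall_fderiv_norm_eq_zero fun x hx =>
      hker (Submodule.subset_span ⟨x, hx, rfl⟩)

/-- A finite set without nonzero common right-orthogonal vector bounds the dimension. -/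
theorem finrank_le_card_of_bjOrth_eq_zero {Y : Type*} [NormedAddCommGroup Y] [NormedSpace ℝ Y]
    (s : Finset Y) (hs : ∀ y, (∀ x ∈ s, BJOrth x y) → y = 0) :
    FiniteDimensional ℝ Y ∧ Module.finrank ℝ Y ≤ s.card := by
  choose f hf hfx using fun x : Y => exists_dual_vector'' ℝ x
  let L : Y →ₗ[ℝ] (s → ℝ) := LinearMap.pi fun x => (f x : Y →ₗ[ℝ] ℝ)
  have hL : Function.Injective L := by
    rw [← LinearMap.ker_eq_bot, LinearMap.ker_eq_bot']
    exact fun y hy => hs y fun x hx =>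
      bjOrth_of_apply_eq_zero (hf x) (hfx x) (congrFun hy ⟨x, hx⟩)
  exact ⟨FiniteDimensional.of_injective L hL, by
    simpa using LinearMap.finrank_le_finrank_of_injective hL⟩

theorem finrank_le_of_bj_preserver {X Y : Type*} [NormedAddCommGroup X] [NormedSpace ℝ X]
    [NormedAddCommGroup Y] [NormedSpace ℝ Y] [FiniteDimensional ℝ X] (T : X → Y)
    (hT : Function.Surjective T) (hbj : ∀ x y : X, BJOrth x y ↔ BJOrth (T x) (T y)) :
    FiniteDimensional ℝ Y ∧ Module.finrank ℝ Y ≤ Module.finrank ℝ X := by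
  classical
  obtain ⟨s, hcard, hs⟩ := exists_finset_bjOrth_eq_zero X
  obtain ⟨hfin, hle⟩ := finrank_le_card_of_bjOrth_eq_zero (s.image T) fun y hy => by
    obtain ⟨x, rfl⟩ := hT y
    have hx : x = 0 := hs x fun z hz => (hbj z x).2 (hy _ (Finset.mem_image_of_mem T hz))
    rw [← bjOrth_self_iff, ← hbj, bjOrth_self_iff]
    exact hx
  exact ⟨hfin, hle.trans (Finset.card_image_le.trans hcard)⟩

/-- A Birkhoff–James orthogonality preserver between Banach spaces, one of which is
finite-dimensional, forces equality of dimensions. -/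
theorem dim_eq_of_bj_preserver
    {X Y : Type*} [NormedAddCommGroup X] [NormedSpace ℝ X] [CompleteSpace X]
    [NormedAddCommGroup Y] [NormedSpace ℝ Y] [CompleteSpace Y]
    [FiniteDimensional ℝ X]
    (T : X → Y) (hbij : Function.Bijective T)
    (hbj : ∀ x y : X, BJOrth x y ↔ BJOrth (T x) (T y)) :
    FiniteDimensional ℝ Y ∧ Module.finrank ℝ X = Module.finrank ℝ Y := by
  obtain ⟨hY, hle⟩ := finrank_le_of_bj_preserver T hbij.surjective hbj
  obtain ⟨S, hST, hTS⟩ := Function.bijective_iff_has_inverse.1 hbij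
  exact ⟨hY, (finrank_le_of_bj_preserver S hST.surjective fun x y => by
    rw [hbj, hTS, hTS]).2.antisymm hle⟩
end

section
/- Let X and Y be smooth real Banach spaces and let T : X → Y be a Birkhoff–James orthogonality preserver. If M is a closed reflexive linear subspace of X (i.e., the canonical embedding of M into its double dual is surjective), then T(M) is a closed linear subspace of Y. -/
/-- A normed space is smooth if the set of supporting functionals at every nonzero
point is a singleton. -/
def SmoothSpace (X : Type*) [NormedAddCommGroup X] [NormedSpace ℝ X] : Prop :=
  ∀ x : X, x ≠ 0 → ∃ f : X →L[ℝ] ℝ, {g : X →L[ℝ] ℝ | ‖g‖ ≤ 1 ∧ g x = ‖x‖} = {f}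

/-- A vector Birkhoff–James orthogonal to `y` has a supporting functional vanishing at `y`. -/
theorem BJOrth.exists_supporting_functional {X : Type*} [NormedAddCommGroup X] [NormedSpace ℝ X]
    {x y : X} (h : BJOrth x y) : ∃ g : X →L[ℝ] ℝ, ‖g‖ ≤ 1 ∧ g x = ‖x‖ ∧ g y = 0 := by
  let S : Submodule ℝ X := Submodule.span ℝ {y}
  obtain ⟨g, hg, hgx⟩ := exists_dual_vector'' ℝ (S.mkQ x)
  have hnorm : ‖S.mkQ x‖ = ‖x‖ := by
    refine le_antisymm (Submodule.Quotient.norm_mk_le S x) ?_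
    refine QuotientAddGroup.le_norm_iff.2 fun m hm => ?_
    have hmem : m - x ∈ S := (Submodule.Quotient.eq S).1 hm
    obtain ⟨l, hl⟩ := Submodule.mem_span_singleton.1 hmem
    simpa [hl] using h l
  refine ⟨g.comp S.mkQL, ?_, ?_, ?_⟩
  · refine ContinuousLinearMap.opNorm_le_bound _ zero_le_one fun z => ?_
    calc ‖g (S.mkQ z)‖ ≤ 1 * ‖S.mkQ z‖ := g.le_of_opNorm_le hg _
      _ ≤ 1 * ‖z‖ := by gcongr; exact Submodule.Quotient.norm_mk_le S z
  · exact hgx.trans hnorm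
  · have : S.mkQ y = 0 := (Submodule.Quotient.mk_eq_zero S).2 (Submodule.mem_span_singleton_self y)
    change g (S.mkQ y) = 0
    rw [this, map_zero]

/-- In a smooth space, the vectors to which a given vector is Birkhoff–James orthogonal form
the kernel of a continuous linear functional. -/
theorem SmoothSpace.exists_bjOrth_iff_apply_eq_zero {X : Type*} [NormedAddCommGroup X]
    [NormedSpace ℝ X] (hX : SmoothSpace X) (x : X) :
    ∃ f : X →L[ℝ] ℝ, ∀ y, BJOrth x y ↔ f y = 0 := by
  rcases eq_or_ne x 0 with rfl | hx
  · exact ⟨0, fun y => by simp [BJOrth]⟩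
  obtain ⟨f, hf⟩ := hX x hx
  obtain ⟨hf1, hfx⟩ : ‖f‖ ≤ 1 ∧ f x = ‖x‖ := hf.ge rfl
  refine ⟨f, fun y => ⟨fun h => ?_, fun h l => ?_⟩⟩
  · obtain ⟨g, hg, hgx, hgy⟩ := h.exists_supporting_functional
    have : g = f := hf.le ⟨hg, hgx⟩
    rwa [← this]
  · calc ‖x‖ = f (x + l • y) := by simp [h, hfx]
      _ ≤ ‖f (x + l • y)‖ := Real.le_norm_self _
      _ ≤ 1 * ‖x + l • y‖ := f.le_of_opNorm_le hf1 _
      _ = ‖x + l • y‖ := one_mul _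

set_option maxSynthPendingDepth 3 in
open Filter Topology in
/-- Reflexive subspaces are proximinal. -/
theorem Submodule.exists_norm_sub_le_of_reflexive {X : Type*} [NormedAddCommGroup X]
    [NormedSpace ℝ X] (M : Submodule ℝ X)
    (hM : Function.Surjective (NormedSpace.inclusionInDoubleDual ℝ M)) (w : X) :
    ∃ m₀ ∈ M, ∀ m ∈ M, ‖w - m₀‖ ≤ ‖w - m‖ := by
  set d := Metric.infDist w (M : Set X)
  have hne : (M : Set X).Nonempty := ⟨0, M.zero_mem⟩
  have hex (n : ℕ) : ∃ m : M, ‖w - m‖ < d + 1 / ((n : ℝ) + 1) := by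
    obtain ⟨m, hm, hlt⟩ := (Metric.infDist_lt_iff hne).1
      (lt_add_of_pos_right d (Nat.one_div_pos_of_nat (α := ℝ) (n := n)))
    exact ⟨⟨m, hm⟩, by simpa [dist_eq_norm] using hlt⟩
  choose u hu using hex
  let J : M → WeakDual ℝ (StrongDual ℝ M) := fun m =>
    StrongDual.toWeakDual (NormedSpace.inclusionInDoubleDual ℝ M m)
  have hbdd (n : ℕ) : J (u n) ∈ WeakDual.toStrongDual ⁻¹' Metric.closedBall
      (0 : StrongDual ℝ (StrongDual ℝ M)) (‖w‖ + d + 1) := by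
    have hun : ‖(u n : X)‖ ≤ ‖w‖ + ‖w - u n‖ := by
      simpa using norm_sub_le w (w - u n)
    have hn : 1 / ((n : ℝ) + 1) ≤ 1 := by
      rw [div_le_one (by positivity)]; simp
    rw [Set.mem_preimage, mem_closedBall_zero_iff]
    calc ‖NormedSpace.inclusionInDoubleDual ℝ M (u n)‖ ≤ ‖u n‖ :=
          NormedSpace.double_dual_bound ℝ M (u n)
      _ = ‖(u n : X)‖ := rfl
      _ ≤ ‖w‖ + d + 1 := by linarith [hu n]
  obtain ⟨Φ, -, hΦ⟩ := (WeakDual.isCompact_closedBall (0 : StrongDual ℝ (StrongDual ℝ M))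
    (‖w‖ + d + 1)).ultrafilter_le_nhds ((hyperfilter ℕ : Ultrafilter ℕ).map fun n => J (u n))
    (le_principal_iff.2 (Filter.mem_map.2 (Filter.univ_mem' hbdd)))
  obtain ⟨m₀, hm₀⟩ := hM (WeakDual.toStrongDual Φ)
  have hlim (f : StrongDual ℝ M) :
      Tendsto (fun n => f (u n)) (hyperfilter ℕ : Filter ℕ) (𝓝 (f m₀)) := by
    have h := ((WeakDual.eval_continuous f).tendsto Φ).comp (show Tendsto _ _ _ from hΦ)
    have hval : Φ f = f m₀ := (DFunLike.congr_fun hm₀ f).symm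
    rwa [hval] at h
  refine ⟨m₀, m₀.2, fun m hm => ?_⟩
  refine le_trans ?_ ((Metric.infDist_le_dist_of_mem hm).trans_eq (dist_eq_norm w m))
  obtain ⟨g, hg, hgw⟩ := exists_dual_vector'' ℝ (w - (m₀ : X))
  have hleft : Tendsto (fun n => g (w - u n)) (hyperfilter ℕ : Filter ℕ) (𝓝 ‖w - m₀‖) := by
    have h := (hlim (g.comp M.subtypeL)).const_sub (g w)
    have hgw' : ‖w - (m₀ : X)‖ = g w - g m₀ := by rw [← map_sub]; exact hgw.symm
    simpa [hgw'] using h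
  have hright : Tendsto (fun n : ℕ => d + 1 / ((n : ℝ) + 1)) (hyperfilter ℕ : Filter ℕ) (𝓝 d) := by
    have h := (tendsto_one_div_add_atTop_nhds_zero_nat (𝕜 := ℝ)).const_add d
    rw [add_zero] at h
    exact h.mono_left Nat.hyperfilter_le_atTop
  refine le_of_tendsto_of_tendsto' hleft hright fun n => ?_
  calc g (w - u n) ≤ ‖g (w - u n)‖ := Real.le_norm_self _
    _ ≤ 1 * ‖w - u n‖ := g.le_of_opNorm_le hg _
    _ ≤ d + 1 / ((n : ℝ) + 1) := by linarith [hu n]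

/-- In a smooth space, a reflexive subspace is the set of all vectors to which every vector
Birkhoff–James orthogonal to that subspace is orthogonal. -/
theorem SmoothSpace.mem_reflexive_iff {X : Type*} [NormedAddCommGroup X] [NormedSpace ℝ X]
    (hX : SmoothSpace X) (M : Submodule ℝ X)
    (hM : Function.Surjective (NormedSpace.inclusionInDoubleDual ℝ M)) (w : X) :
    w ∈ M ↔ ∀ z, (∀ m ∈ M, BJOrth z m) → BJOrth z w := by
  refine ⟨fun hw z hz => hz w hw, fun h => ?_⟩
  obtain ⟨m₀, hm₀, hmin⟩ := M.exists_norm_sub_le_of_reflexive hM w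
  have hz : ∀ m ∈ M, BJOrth (w - m₀) m := fun m hm l => by
    have := hmin (m₀ - l • m) (M.sub_mem hm₀ (M.smul_mem l hm))
    rwa [sub_sub_eq_add_sub, add_sub_right_comm] at this
  obtain ⟨f, hf⟩ := hX.exists_bjOrth_iff_apply_eq_zero (w - m₀)
  have hself : BJOrth (w - m₀) (w - m₀) := by
    rw [hf, map_sub, (hf w).1 (h _ hz), (hf m₀).1 (hz m₀ hm₀), sub_zero]
  have hzero : w - m₀ = 0 := by simpa using hself (-1)
  rwa [sub_eq_zero.1 hzero]

/-- A Birkhoff–James orthogonality preserver between smooth Banach spaces maps a closed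
reflexive subspace onto a closed subspace. -/
theorem bj_preserver_image_of_reflexive_subspace_is_closed_subspace
    {X Y : Type*} [NormedAddCommGroup X] [NormedSpace ℝ X] [CompleteSpace X]
    [NormedAddCommGroup Y] [NormedSpace ℝ Y] [CompleteSpace Y]
    (hX : SmoothSpace X) (hY : SmoothSpace Y)
    (T : X → Y) (hbij : Function.Bijective T)
    (hbj : ∀ x y : X, BJOrth x y ↔ BJOrth (T x) (T y))
    (M : Submodule ℝ X) (hMclosed : IsClosed (M : Set X))
    (hMrefl : Function.Surjective (NormedSpace.inclusionInDoubleDual ℝ M)) :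
    ∃ N : Submodule ℝ Y, IsClosed (N : Set Y) ∧ T '' (M : Set X) = (N : Set Y) := by
  choose f hf using hY.exists_bjOrth_iff_apply_eq_zero
  let Z : Set X := {z | ∀ m ∈ M, BJOrth z m}
  refine ⟨⨅ z ∈ Z, (f (T z)).ker, ?_, ?_⟩
  · simp only [Submodule.coe_iInf]
    exact isClosed_biInter fun z _ => (f (T z)).isClosed_ker
  · ext v
    obtain ⟨w, rfl⟩ := hbij.2 v
    rw [hbij.1.mem_set_image, SetLike.mem_coe, hX.mem_reflexive_iff M hMrefl]
    simp [Z, hbj, hf]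
end

section
/- (Mackey) Let X and Y be real Banach spaces with dim X ≥ 3, let M₁(X) and M₁(Y) denote the families of all one-dimensional linear subspaces of X and Y respectively, and let ρ : M₁(X) → M₁(Y) be a bijection that preserves linear independence of finite collections in both directions; that is, for every finite collection M₁, …, Mₙ ∈ M₁(X) and nonzero vectors xᵢ ∈ Mᵢ and yᵢ ∈ ρ(Mᵢ), the set {x₁, …, xₙ} is linearly independent if and only if {y₁, …, yₙ} is linearly independent. Then there exists a linear bijection T : X → Y such that T(M) = ρ(M) for every M ∈ M₁(X). -/
section LinearIndependencePreserving

variable {X Y : Type*} [AddCommGroup X] [Module ℝ X] [AddCommGroup Y] [Module ℝ Y]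

theorem linearIndependent_triple_iff {x y z : X} :
    LinearIndependent ℝ ![x, y, z] ↔
      ∀ a b c : ℝ, a • x + b • y + c • z = 0 → a = 0 ∧ b = 0 ∧ c = 0 := by
  rw [Fintype.linearIndependent_iff]
  constructor
  · intro h a b c habc
    have := h ![a, b, c] (by simpa [Fin.sum_univ_three] using habc)
    exact ⟨this 0, this 1, this 2⟩
  · intro h g hg
    obtain ⟨h0, h1, h2⟩ := h (g 0) (g 1) (g 2) (by simpa [Fin.sum_univ_three] using hg)
    intro i
    fin_cases i <;> assumption

theorem linearIndependent_triple_iff_pair {x y z : X} :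
    LinearIndependent ℝ ![x, y, z] ↔
      LinearIndependent ℝ ![y, z] ∧ x ∉ Submodule.span ℝ {y, z} := by
  simpa [Set.pair_comm z y] using linearIndependent_finCons (K := ℝ) (x := x) (v := ![y, z])

theorem mem_span_singleton_comm_of_ne_zero {u w : X} (hu : u ≠ 0)
    (h : u ∈ Submodule.span ℝ {w}) : w ∈ Submodule.span ℝ {u} := by
  obtain ⟨a, rfl⟩ := Submodule.mem_span_singleton.1 h
  have ha : a ≠ 0 := fun h => hu (by simp [h])
  exact Submodule.mem_span_singleton.2 ⟨a⁻¹, inv_smul_smul₀ ha w⟩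

theorem LinearIndependent.triple_left_right {x y e : X} (h : LinearIndependent ℝ ![x, y, e]) :
    LinearIndependent ℝ ![x, e] := by
  rw [linearIndependent_triple_iff] at h
  rw [LinearIndependent.pair_iff]
  intro s t hst
  have := h s 0 t (by simpa using hst)
  exact ⟨this.1, this.2.2⟩

theorem LinearIndependent.triple_swap {x y e : X} (h : LinearIndependent ℝ ![x, y, e]) :
    LinearIndependent ℝ ![y, x, e] := by
  rw [linearIndependent_triple_iff] at h ⊢
  intro a b c habc
  have := h b a c (by rw [← habc]; module)
  exact ⟨this.2.1, this.1, this.2.2⟩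

theorem exists_mem_ne_zero_of_finrank_eq_one {M : Submodule ℝ X} (hM : Module.finrank ℝ M = 1) :
    ∃ x ∈ M, x ≠ 0 :=
  Submodule.exists_mem_ne_zero_of_ne_bot <| by
    rintro rfl
    simp at hM

theorem span_singleton_eq_of_finrank_eq_one {M : Submodule ℝ X} (hM : Module.finrank ℝ M = 1)
    {x : X} (hx : x ∈ M) (hx0 : x ≠ 0) : Submodule.span ℝ {x} = M := by
  have : Module.Finite ℝ M := Module.finite_of_finrank_eq_succ hM
  exact Submodule.eq_of_le_of_finrank_eq ((Submodule.span_singleton_le_iff_mem _ _).2 hx)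
    ((finrank_span_singleton hx0).trans hM.symm)

/-- A map under which a finite family is linearly independent iff its image is. -/
def PreservesLinearIndependence (f : X → Y) : Prop :=
  ∀ (n : ℕ) (v : Fin n → X), LinearIndependent ℝ v ↔ LinearIndependent ℝ (f ∘ v)

/-- `u` lies on the image of the line through `x`, and `u + f e` on the image of the line
through `x + e`. -/
def IsNormalizedImage (f : X → Y) (e x : X) (u : Y) : Prop :=
  u ∈ Submodule.span ℝ {f x} ∧ u + f e ∈ Submodule.span ℝ {f (x + e)}

namespace PreservesLinearIndependence

variable {f : X → Y}

theorem mem_span_range_iff (hf : PreservesLinearIndependence f) {n : ℕ} {v : Fin n → X}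
    (hv : LinearIndependent ℝ v) (z : X) :
    f z ∈ Submodule.span ℝ (Set.range (f ∘ v)) ↔ z ∈ Submodule.span ℝ (Set.range v) := by
  have h := hf (n + 1) (Fin.cons z v)
  rw [Fin.comp_cons, linearIndependent_finCons, linearIndependent_finCons, ← hf n v] at h
  simpa [hv, not_iff_not] using h.symm

theorem map_eq_zero_iff (hf : PreservesLinearIndependence f) {x : X} : f x = 0 ↔ x = 0 := by
  simpa using hf.mem_span_range_iff (v := ![]) linearIndependent_empty_type x

theorem mem_span_singleton_iff (hf : PreservesLinearIndependence f) {x : X} (hx : x ≠ 0) (z : X) :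
    f z ∈ Submodule.span ℝ {f x} ↔ z ∈ Submodule.span ℝ {x} := by
  simpa [Set.range_comp] using
    hf.mem_span_range_iff (v := ![x]) (LinearIndependent.of_subsingleton 0 hx) z

theorem mem_span_pair_iff (hf : PreservesLinearIndependence f) {x y : X}
    (h : LinearIndependent ℝ ![x, y]) (z : X) :
    f z ∈ Submodule.span ℝ {f x, f y} ↔ z ∈ Submodule.span ℝ {x, y} := by
  simpa [Set.range_comp, Set.image_insert_eq, Set.pair_comm y x, Set.pair_comm (f y) (f x)] using
    hf.mem_span_range_iff (v := ![x, y]) h z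

theorem map_smul_mem (hf : PreservesLinearIndependence f) (t : ℝ) (x : X) :
    f (t • x) ∈ Submodule.span ℝ {f x} := by
  rcases eq_or_ne x 0 with rfl | hx
  · simp [hf.map_eq_zero_iff.2 rfl]
  · exact (hf.mem_span_singleton_iff hx _).2
      (Submodule.smul_mem _ _ (Submodule.mem_span_singleton_self x))

theorem pair (hf : PreservesLinearIndependence f) {x y : X}
    (h : LinearIndependent ℝ ![x, y]) : LinearIndependent ℝ ![f x, f y] := by
  have := (hf 2 ![x, y]).1 h
  convert this using 1
  ext i; fin_cases i <;> rfl

theorem triple (hf : PreservesLinearIndependence f) {x y z : X}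
    (h : LinearIndependent ℝ ![x, y, z]) : LinearIndependent ℝ ![f x, f y, f z] := by
  have := (hf 3 ![x, y, z]).1 h
  convert this using 1
  ext i; fin_cases i <;> rfl

end PreservesLinearIndependence

namespace IsNormalizedImage

variable {f : X → Y} {e x y : X} {u v : Y}

theorem exists_of_linearIndependent (hf : PreservesLinearIndependence f)
    (h : LinearIndependent ℝ ![x, e]) : ∃ u, IsNormalizedImage f e x u := by
  have hx : x ≠ 0 := h.ne_zero 0
  have hmem : f (x + e) ∈ Submodule.span ℝ {f x, f e} :=
    (hf.mem_span_pair_iff h _).2 (Submodule.mem_span_pair.2 ⟨1, 1, by simp⟩)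
  obtain ⟨p, q, hpq⟩ := Submodule.mem_span_pair.1 hmem
  have hq : q ≠ 0 := by
    rintro rfl
    have hxe : x + e ∈ Submodule.span ℝ {x} := (hf.mem_span_singleton_iff hx _).1
      (Submodule.mem_span_singleton.2 ⟨p, by simpa using hpq⟩)
    obtain ⟨a, ha⟩ := Submodule.mem_span_singleton.1 hxe
    have := LinearIndependent.pair_iff.1 h (1 - a) 1 (by rw [sub_smul, ha]; module)
    exact one_ne_zero this.2
  refine ⟨(q⁻¹ * p) • f x, Submodule.mem_span_singleton.2 ⟨_, rfl⟩,
    Submodule.mem_span_singleton.2 ⟨q⁻¹, ?_⟩⟩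
  rw [← hpq, smul_add, smul_smul, inv_smul_smul₀ hq]

theorem unique (hf : PreservesLinearIndependence f) (h : LinearIndependent ℝ ![x, e])
    (hu : IsNormalizedImage f e x u) (hv : IsNormalizedImage f e x v) : u = v := by
  have hl : LinearIndependent ℝ ![x + e, x] := by
    rw [LinearIndependent.pair_iff] at h ⊢
    intro s t hst
    obtain ⟨h1, h2⟩ := h (s + t) s (by rw [← hst]; module)
    exact ⟨h2, by linarith⟩
  obtain ⟨p, hp⟩ := Submodule.mem_span_singleton.1 hu.1
  obtain ⟨r, hr⟩ := Submodule.mem_span_singleton.1 hu.2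
  obtain ⟨p', hp'⟩ := Submodule.mem_span_singleton.1 hv.1
  obtain ⟨r', hr'⟩ := Submodule.mem_span_singleton.1 hv.2
  have := (LinearIndependent.pair_iff.1 (hf.pair hl) (r - r') (p' - p) (by
    rw [sub_smul, sub_smul, hr, hr', hp, hp']; module)).2
  rw [← hp, ← hp', sub_eq_zero.1 this]

theorem ne_zero (hf : PreservesLinearIndependence f) (h : LinearIndependent ℝ ![x, e])
    (hu : IsNormalizedImage f e x u) : u ≠ 0 := by
  rintro rfl
  have he : e ≠ 0 := h.ne_zero 1
  have hxe := mem_span_singleton_comm_of_ne_zero (hf.map_eq_zero_iff.not.2 he)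
    (by simpa using hu.2)
  obtain ⟨a, ha⟩ := Submodule.mem_span_singleton.1 ((hf.mem_span_singleton_iff he _).1 hxe)
  have := LinearIndependent.pair_iff.1 h 1 (1 - a) (by rw [sub_smul, ha]; module)
  exact one_ne_zero this.1

theorem pair (hf : PreservesLinearIndependence f) (h : LinearIndependent ℝ ![x, e])
    (hu : IsNormalizedImage f e x u) : LinearIndependent ℝ ![u, f e] := by
  have hu0 := hu.ne_zero hf h
  obtain ⟨p, rfl⟩ := Submodule.mem_span_singleton.1 hu.1
  have hp : p ≠ 0 := fun h => hu0 (by simp [h])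
  have := hf.pair h
  rw [LinearIndependent.pair_iff] at this ⊢
  intro s t hst
  simpa [hp] using this (s * p) t (by rw [← hst]; module)

theorem triple (hf : PreservesLinearIndependence f) (h : LinearIndependent ℝ ![x, y, e])
    (hu : IsNormalizedImage f e x u) (hv : IsNormalizedImage f e y v) :
    LinearIndependent ℝ ![u, v, f e] := by
  have hu0 := hu.ne_zero hf h.triple_left_right
  have hv0 := hv.ne_zero hf h.triple_swap.triple_left_right
  obtain ⟨p, rfl⟩ := Submodule.mem_span_singleton.1 hu.1
  obtain ⟨q, rfl⟩ := Submodule.mem_span_singleton.1 hv.1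
  have hp : p ≠ 0 := fun h => hu0 (by simp [h])
  have hq : q ≠ 0 := fun h => hv0 (by simp [h])
  have := hf.triple h
  rw [linearIndependent_triple_iff] at this ⊢
  intro a b c habc
  simpa [hp, hq] using this (a * p) (b * q) c (by rw [← habc]; module)

theorem exists_smul_add_smul (hf : PreservesLinearIndependence f)
    (h : LinearIndependent ℝ ![x, y, e])
    (hu : IsNormalizedImage f e x u) (hv : IsNormalizedImage f e y v) :
    ∃ a b : ℝ, f (x + y + e) = a • u + b • (v + f e) := by
  have hl : LinearIndependent ℝ ![x, y + e] := by
    rw [linearIndependent_triple_iff] at h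
    rw [LinearIndependent.pair_iff]
    intro s t hst
    have := h s t t (by rw [← hst]; module)
    exact ⟨this.1, this.2.1⟩
  have hmem : f (x + y + e) ∈ Submodule.span ℝ {f x, f (y + e)} :=
    (hf.mem_span_pair_iff hl _).2 (Submodule.mem_span_pair.2 ⟨1, 1, by module⟩)
  have hvE : v + f e ≠ 0 := by
    intro h0
    have := (LinearIndependent.pair_iff.1 (hv.pair hf h.triple_swap.triple_left_right) 1 1
      (by simpa using h0)).1
    exact one_ne_zero this
  obtain ⟨a, ha⟩ := Submodule.mem_span_singleton.1
    (mem_span_singleton_comm_of_ne_zero (hu.ne_zero hf h.triple_left_right) hu.1)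
  obtain ⟨b, hb⟩ := Submodule.mem_span_singleton.1 (mem_span_singleton_comm_of_ne_zero hvE hv.2)
  obtain ⟨c, d, hcd⟩ := Submodule.mem_span_pair.1 hmem
  exact ⟨c * a, d * b, by rw [← hcd, ← ha, ← hb, smul_smul, smul_smul]⟩

theorem add (hf : PreservesLinearIndependence f) (h : LinearIndependent ℝ ![x, y, e])
    (hu : IsNormalizedImage f e x u) (hv : IsNormalizedImage f e y v) :
    IsNormalizedImage f e (x + y) (u + v) := by
  have hE := linearIndependent_triple_iff.1 (hu.triple hf h hv)
  obtain ⟨a, b, hab⟩ := exists_smul_add_smul hf h hu hv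
  obtain ⟨c, d, hcd⟩ := exists_smul_add_smul hf h.triple_swap hv hu
  rw [add_comm y x] at hcd
  have hl := linearIndependent_triple_iff.1 h
  have hxy : LinearIndependent ℝ ![x, y] := LinearIndependent.pair_iff.2 fun s t hst => by
    have := hl s t 0 (by simpa using hst)
    exact ⟨this.1, this.2.1⟩
  have hxye : LinearIndependent ℝ ![x + y, e] := LinearIndependent.pair_iff.2 fun s t hst => by
    have := hl s s t (by rw [← hst]; module)
    exact ⟨this.1, this.2.2⟩
  obtain ⟨r, s, hrs⟩ := Submodule.mem_span_pair.1 ((hf.mem_span_pair_iff hxye (x + y + e)).2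
    (Submodule.mem_span_pair.2 ⟨1, 1, by module⟩))
  obtain ⟨p, q, hpq⟩ : ∃ p q : ℝ, p • u + q • v = f (x + y) := by
    obtain ⟨p, q, hpq⟩ := Submodule.mem_span_pair.1 ((hf.mem_span_pair_iff hxy (x + y)).2
      (Submodule.mem_span_pair.2 ⟨1, 1, by module⟩))
    obtain ⟨p', hp'⟩ := Submodule.mem_span_singleton.1
      (mem_span_singleton_comm_of_ne_zero (hu.ne_zero hf h.triple_left_right) hu.1)
    obtain ⟨q', hq'⟩ := Submodule.mem_span_singleton.1
      (mem_span_singleton_comm_of_ne_zero (hv.ne_zero hf h.triple_swap.triple_left_right) hv.1)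
    exact ⟨p * p', q * q', by rw [← hpq, ← hp', ← hq', smul_smul, smul_smul]⟩
  obtain ⟨h1, h2, h3⟩ := hE (a - d) (b - c) (b - d) (by
    linear_combination (norm := module) hcd - hab)
  obtain ⟨h4, h5, h6⟩ := hE (a - r * p) (b - r * q) (b - s) (by
    rw [← hpq] at hrs
    linear_combination (norm := module) -hab - hrs)
  obtain rfl : a = b := by linarith
  have ha : a ≠ 0 := by
    rintro rfl
    have h0 : x + y + e = 0 := hf.map_eq_zero_iff.1 (by simpa using hab)
    exact one_ne_zero (hl 1 1 1 (by simpa using h0)).1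
  constructor
  · refine Submodule.mem_span_singleton.2 ⟨a⁻¹ * r, ?_⟩
    have hp : a⁻¹ * r * p = 1 := by rw [mul_assoc, ← sub_eq_zero.1 h4, inv_mul_cancel₀ ha]
    have hq : a⁻¹ * r * q = 1 := by rw [mul_assoc, ← sub_eq_zero.1 h5, inv_mul_cancel₀ ha]
    rw [← hpq, smul_add, smul_smul, smul_smul, hp, hq, one_smul, one_smul]
  · refine Submodule.mem_span_singleton.2 ⟨a⁻¹, ?_⟩
    rw [hab, ← smul_add, inv_smul_smul₀ ha, add_assoc]

end IsNormalizedImage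

namespace PreservesLinearIndependence

variable {f : X → Y} {e : X} {g : X → Y}

theorem normalizedImage_add (hf : PreservesLinearIndependence f)
    (hg : ∀ x, LinearIndependent ℝ ![x, e] → IsNormalizedImage f e x (g x)) {x y : X}
    (h : LinearIndependent ℝ ![x, y, e]) : g (x + y) = g x + g y := by
  have hl : LinearIndependent ℝ ![x + y, e] := LinearIndependent.pair_iff.2 fun s t hst => by
    have := linearIndependent_triple_iff.1 h s s t (by rw [← hst]; module)
    exact ⟨this.1, this.2.2⟩
  exact (hg _ hl).unique hf hl
    ((hg x h.triple_left_right).add hf h (hg y h.triple_swap.triple_left_right))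

theorem normalizedImage_smul (hf : PreservesLinearIndependence f)
    (hdim : ∀ x y : X, ∃ z, z ∉ Submodule.span ℝ {x, y})
    (hg : ∀ x, LinearIndependent ℝ ![x, e] → IsNormalizedImage f e x (g x)) (hg0 : g 0 = 0)
    {x : X} (hx : LinearIndependent ℝ ![x, e]) (t : ℝ) : g (t • x) = t • g x := by
  have pair_smul {x : X} (hx : LinearIndependent ℝ ![x, e]) {t : ℝ} (ht : t ≠ 0) :
      LinearIndependent ℝ ![t • x, e] := by
    rw [LinearIndependent.pair_iff] at hx ⊢
    intro a b hab
    simpa [ht] using hx (a * t) b (by rw [← hab]; module)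
  have hne {x : X} (hx : LinearIndependent ℝ ![x, e]) : g x ≠ 0 := (hg x hx).ne_zero hf hx
  have hex (x : X) (t : ℝ) : LinearIndependent ℝ ![x, e] → ∃ c : ℝ, g (t • x) = c • g x := by
    intro hx
    rcases eq_or_ne t 0 with rfl | ht
    · exact ⟨0, by simp [hg0]⟩
    obtain ⟨a, ha⟩ := Submodule.mem_span_singleton.1 (hg _ (pair_smul hx ht)).1
    obtain ⟨b, hb⟩ := Submodule.mem_span_singleton.1 (hf.map_smul_mem t x)
    obtain ⟨c, hc⟩ := Submodule.mem_span_singleton.1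
      (mem_span_singleton_comm_of_ne_zero (hne hx) (hg x hx).1)
    exact ⟨a * (b * c), by rw [← ha, ← hb, ← hc]; module⟩
  choose σ hσ using hex
  have third {x : X} (hx : LinearIndependent ℝ ![x, e]) :
      ∃ y, LinearIndependent ℝ ![y, x, e] := by
    obtain ⟨y, hy⟩ := hdim x e
    exact ⟨y, linearIndependent_triple_iff_pair.2 ⟨hx, hy⟩⟩
  have σ_eq {x y : X} (h : LinearIndependent ℝ ![x, y, e]) (hx : LinearIndependent ℝ ![x, e])
      (hy : LinearIndependent ℝ ![y, e]) (t : ℝ) : σ x t hx = σ y t hy := by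
    rcases eq_or_ne t 0 with rfl | ht
    · have h1 := hσ x 0 hx
      have h2 := hσ y 0 hy
      rw [zero_smul, hg0] at h1 h2
      rw [(smul_eq_zero.1 h1.symm).resolve_right (hne hx),
        (smul_eq_zero.1 h2.symm).resolve_right (hne hy)]
    have hxy : LinearIndependent ℝ ![x + y, e] := LinearIndependent.pair_iff.2 fun s t hst => by
      have := linearIndependent_triple_iff.1 h s s t (by rw [← hst]; module)
      exact ⟨this.1, this.2.2⟩
    have ht3 : LinearIndependent ℝ ![t • x, t • y, e] := by
      rw [linearIndependent_triple_iff] at h ⊢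
      intro a b c habc
      simpa [ht] using h (a * t) (b * t) c (by rw [← habc]; module)
    have h1 := hσ (x + y) t hxy
    rw [smul_add, hf.normalizedImage_add hg ht3, hf.normalizedImage_add hg h, hσ x t hx,
      hσ y t hy] at h1
    obtain ⟨h2, h3, -⟩ := linearIndependent_triple_iff.1 ((hg x hx).triple hf h (hg y hy))
      (σ x t hx - σ (x + y) t hxy) (σ y t hy - σ (x + y) t hxy) 0 (by
        linear_combination (norm := module) h1)
    linarith
  have σ_smul (s : ℝ) {t : ℝ} (ht : t ≠ 0) : σ (t • x) s (pair_smul hx ht) = σ x s hx := by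
    obtain ⟨y, hy⟩ := third hx
    have hy' : LinearIndependent ℝ ![y, t • x, e] := by
      rw [linearIndependent_triple_iff] at hy ⊢
      intro a b c habc
      simpa [ht] using hy a (b * t) c (by rw [← habc]; module)
    rw [← σ_eq hy hy.triple_left_right hx, ← σ_eq hy' hy.triple_left_right]
  have cancel {a b : ℝ} (h : a • g x = b • g x) : a = b := smul_left_injective ℝ (hne hx) h
  let τ : ℝ →+* ℝ :=
    { toFun := fun t => σ x t hx
      map_one' := cancel (by rw [← hσ, one_smul, one_smul])
      map_zero' := cancel (by rw [← hσ, zero_smul, zero_smul, hg0])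
      map_mul' := fun s t => cancel (by
        rcases eq_or_ne t 0 with rfl | ht
        · rw [mul_smul, ← hσ, ← hσ, mul_zero, zero_smul, hg0, smul_zero]
        · rw [← hσ, mul_smul, mul_smul, hσ (t • x) s (pair_smul hx ht), σ_smul s ht, hσ x t hx])
      map_add' := fun s t => cancel (by
        obtain ⟨y, hy⟩ := third hx
        have hy3 := linearIndependent_triple_iff.1 hy
        have add_y (r : ℝ) : g (r • x + y) = σ x r hx • g x + g y := by
          rcases eq_or_ne r 0 with rfl | hr
          · rw [← hσ, zero_smul, hg0, zero_add, zero_add]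
          · rw [← hσ]
            refine hf.normalizedImage_add hg (linearIndependent_triple_iff.2 fun a b c habc => ?_)
            have := hy3 b (a * r) c (by rw [← habc]; module)
            simpa [hr, and_left_comm] using this
        rcases eq_or_ne s 0 with rfl | hs
        · rw [zero_add, add_smul, ← hσ x 0, zero_smul, hg0, zero_add]
        have h1 : g (s • x + (t • x + y)) = g (s • x) + g (t • x + y) := by
          refine hf.normalizedImage_add hg (linearIndependent_triple_iff.2 fun a b c habc => ?_)
          obtain ⟨h1, h2, h3⟩ := hy3 b (a * s + b * t) c (by rw [← habc]; module)
          subst h1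
          simpa [hs, h3] using h2
        rw [← add_assoc, ← add_smul, add_y, add_y, hσ x s hx, ← add_assoc] at h1
        rw [add_right_cancel h1, add_smul]) }
  rw [hσ x t hx]
  congr 1
  exact congrArg (fun ψ : ℝ →+* ℝ => ψ t) (Subsingleton.elim τ (RingHom.id ℝ))

/-- The fundamental theorem of projective geometry over `ℝ`: a map preserving and reflecting
linear independence is, up to scalar factors, an injective linear map. -/
theorem exists_linearMap (hf : PreservesLinearIndependence f)
    (hdim : ∀ x y : X, ∃ z, z ∉ Submodule.span ℝ {x, y}) :
    ∃ T : X →ₗ[ℝ] Y, ∀ x, T x ∈ Submodule.span ℝ {f x} ∧ (x ≠ 0 → T x ≠ 0) := by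
  obtain ⟨e, he'⟩ := hdim 0 0
  have he : e ≠ 0 := by simpa using he'
  obtain ⟨ψ, hψ⟩ : ∃ ψ : Module.Dual ℝ X, ψ e ≠ 0 := by
    by_contra! h
    exact he ((Module.forall_dual_apply_eq_zero_iff ℝ e).1 h)
  let φ : Module.Dual ℝ X := (ψ e)⁻¹ • ψ
  have hφ : φ e = 1 := by simp [φ, hψ]
  have pair_of_ker {x : X} (hx0 : x ≠ 0) (hx : φ x = 0) : LinearIndependent ℝ ![x, e] := by
    refine LinearIndependent.pair_iff.2 fun s t hst => ?_
    have ht : t = 0 := by simpa [hx, hφ] using congrArg φ hst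
    subst ht
    simpa [hx0] using hst
  have hex (x : X) : ∃ u, (LinearIndependent ℝ ![x, e] ∨ x = 0) → IsNormalizedImage f e x u := by
    by_cases h : LinearIndependent ℝ ![x, e]
    · obtain ⟨u, hu⟩ := IsNormalizedImage.exists_of_linearIndependent hf h
      exact ⟨u, fun _ => hu⟩
    · refine ⟨0, ?_⟩
      rintro (h' | rfl)
      · exact absurd h' h
      · simp [IsNormalizedImage, Submodule.mem_span_singleton_self]
  choose g hg' using hex
  have hg (x : X) (h : LinearIndependent ℝ ![x, e]) := hg' x (Or.inl h)
  have hg0 : g 0 = 0 := by simpa [hf.map_eq_zero_iff.2 rfl] using (hg' 0 (Or.inr rfl)).1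
  have g_smul {x : X} (hx : φ x = 0) (t : ℝ) : g (t • x) = t • g x := by
    rcases eq_or_ne x 0 with rfl | hx0
    · simp [hg0]
    · exact hf.normalizedImage_smul hdim hg hg0 (pair_of_ker hx0 hx) t
  have g_add {x y : X} (hx : φ x = 0) (hy : φ y = 0) : g (x + y) = g x + g y := by
    rcases eq_or_ne y 0 with rfl | hy0
    · simp [hg0]
    by_cases h : LinearIndependent ℝ ![x, y, e]
    · exact hf.normalizedImage_add hg h
    rw [linearIndependent_triple_iff_pair, not_and_not_right] at h
    obtain ⟨a, b, rfl⟩ := Submodule.mem_span_pair.1 (h (pair_of_ker hy0 hy))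
    have hb : b = 0 := by simpa [hy, hφ] using hx
    subst hb
    have hs : a • y + (0 : ℝ) • e + y = (a + 1) • y := by module
    rw [hs, g_smul hy, zero_smul, add_zero, g_smul hy, add_smul, one_smul]
  have proj_mem (x : X) : φ (x - φ x • e) = 0 := by simp [hφ]
  refine ⟨
    { toFun := fun x => g (x - φ x • e) + φ x • f e
      map_add' := fun x y => ?_
      map_smul' := fun t x => ?_ }, fun x => ⟨?_, fun hx0 h0 => ?_⟩⟩
  · have : x + y - φ (x + y) • e = (x - φ x • e) + (y - φ y • e) := by
      rw [map_add]; module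
    rw [this, g_add (proj_mem x) (proj_mem y), map_add]
    module
  · have : t • x - φ (t • x) • e = t • (x - φ x • e) := by
      rw [map_smul, smul_eq_mul]; module
    rw [this, g_smul (proj_mem x), map_smul, smul_eq_mul, RingHom.id_apply]
    module
  · change g (x - φ x • e) + φ x • f e ∈ _
    rcases eq_or_ne (φ x) 0 with ht | ht
    · rw [ht, zero_smul, zero_smul, sub_zero, add_zero]
      rcases eq_or_ne x 0 with rfl | hx0
      · simp [hg0]
      · exact (hg x (pair_of_ker hx0 ht)).1
    · obtain ⟨z, hz⟩ : ∃ z, z = (φ x)⁻¹ • (x - φ x • e) := ⟨_, rfl⟩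
      have hzφ : φ z = 0 := by rw [hz, map_smul, proj_mem, smul_zero]
      have hxz : x - φ x • e = φ x • z := by rw [hz, smul_inv_smul₀ ht]
      have hze : z + e = (φ x)⁻¹ • x := by rw [hz, smul_sub, inv_smul_smul₀ ht, sub_add_cancel]
      have hnorm : IsNormalizedImage f e z (g z) := hg' z (by
        rcases eq_or_ne z 0 with h | h
        · exact Or.inr h
        · exact Or.inl (pair_of_ker h hzφ))
      rw [hxz, g_smul hzφ, ← smul_add]
      refine Submodule.smul_mem _ _ ?_
      have hmem := hf.map_smul_mem (φ x)⁻¹ x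
      rw [← hze] at hmem
      exact (Submodule.span_singleton_le_iff_mem _ _).2 hmem hnorm.2
  · change g (x - φ x • e) + φ x • f e = 0 at h0
    rcases eq_or_ne (x - φ x • e) 0 with h | h
    · rw [h, hg0, zero_add, smul_eq_zero, hf.map_eq_zero_iff] at h0
      rw [h0.resolve_right he, zero_smul, sub_zero] at h
      exact hx0 h
    · have hl := pair_of_ker h (proj_mem x)
      have := (LinearIndependent.pair_iff.1 ((hg _ hl).pair hf hl) 1 (φ x) (by simpa using h0)).1
      exact one_ne_zero this

end PreservesLinearIndependence

end LinearIndependencePreserving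

/-- (Mackey) A bijection between the families of one-dimensional subspaces of two real
Banach spaces (with `dim X ≥ 3`) preserving linear independence of finite collections in
both directions is induced by a linear bijection. -/
theorem mackey_fundamental_theorem
    {X Y : Type*} [NormedAddCommGroup X] [NormedSpace ℝ X] [CompleteSpace X]
    [NormedAddCommGroup Y] [NormedSpace ℝ Y] [CompleteSpace Y]
    (hdim : 3 ≤ Module.rank ℝ X)
    (ρ : {M : Submodule ℝ X // Module.finrank ℝ M = 1} ≃
         {N : Submodule ℝ Y // Module.finrank ℝ N = 1})
    (hρ : ∀ (n : ℕ) (M : Fin n → {M : Submodule ℝ X // Module.finrank ℝ M = 1})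
        (x : Fin n → X) (y : Fin n → Y),
        (∀ i, x i ∈ (M i).1) → (∀ i, x i ≠ 0) →
        (∀ i, y i ∈ (ρ (M i)).1) → (∀ i, y i ≠ 0) →
        (LinearIndependent ℝ x ↔ LinearIndependent ℝ y)) :
    ∃ T : X ≃ₗ[ℝ] Y, ∀ M : {M : Submodule ℝ X // Module.finrank ℝ M = 1},
      Submodule.map (T : X →ₗ[ℝ] Y) M.1 = (ρ M).1 := by
  let line (x : X) (hx : x ≠ 0) : {M : Submodule ℝ X // Module.finrank ℝ M = 1} :=
    ⟨Submodule.span ℝ {x}, finrank_span_singleton hx⟩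
  have hex (x : X) : ∃ y : Y, (y = 0 ↔ x = 0) ∧ ∀ hx : x ≠ 0, y ∈ (ρ (line x hx)).1 := by
    rcases eq_or_ne x 0 with rfl | hx
    · exact ⟨0, by simp⟩
    · obtain ⟨y, hy, hy0⟩ := exists_mem_ne_zero_of_finrank_eq_one (ρ (line x hx)).2
      exact ⟨y, by simp [hy0, hx], fun _ => hy⟩
  choose f hf0 hfmem using hex
  have hf : PreservesLinearIndependence f := by
    intro n v
    by_cases h : ∀ i, v i ≠ 0
    · exact hρ n (fun i => line (v i) (h i)) v (f ∘ v)
        (fun i => Submodule.mem_span_singleton_self _) h (fun i => hfmem (v i) (h i))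
        (fun i => (hf0 _).not.2 (h i))
    · push Not at h
      obtain ⟨i, hi⟩ := h
      exact iff_of_false (fun hl => hl.ne_zero i hi) (fun hl => hl.ne_zero i ((hf0 _).2 hi))
  have hdim' (x y : X) : ∃ z, z ∉ Submodule.span ℝ {x, y} := by
    by_contra! h
    have htop : Submodule.span ℝ {x, y} = ⊤ := Submodule.eq_top_iff'.2 h
    have hle : Module.rank ℝ X ≤ 2 := by
      rw [← rank_top ℝ X, ← htop]
      exact (rank_span_le _).trans ((Cardinal.mk_insert_le).trans (by
        rw [Cardinal.mk_singleton]; norm_num))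
    exact absurd (hdim.trans hle) (by norm_num)
  obtain ⟨T, hT⟩ := hf.exists_linearMap hdim'
  have exists_line (M : {M : Submodule ℝ X // Module.finrank ℝ M = 1}) :
      ∃ x, ∃ hx : x ≠ 0, M = line x hx := by
    obtain ⟨x, hx, hx0⟩ := exists_mem_ne_zero_of_finrank_eq_one M.2
    exact ⟨x, hx0, Subtype.ext (span_singleton_eq_of_finrank_eq_one M.2 hx hx0).symm⟩
  have span_T {x : X} (hx : x ≠ 0) : Submodule.span ℝ {T x} = (ρ (line x hx)).1 :=
    span_singleton_eq_of_finrank_eq_one (ρ (line x hx)).2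
      ((Submodule.span_singleton_le_iff_mem _ _).2 (hfmem x hx) (hT x).1) ((hT x).2 hx)
  have hinj : Function.Injective T := (injective_iff_map_eq_zero T).2 fun x hx =>
    by_contra fun hx0 => (hT x).2 hx0 hx
  have hsurj : Function.Surjective T := by
    intro y
    rcases eq_or_ne y 0 with rfl | hy
    · exact ⟨0, map_zero T⟩
    obtain ⟨x, hx, hline⟩ := exists_line (ρ.symm ⟨Submodule.span ℝ {y}, finrank_span_singleton hy⟩)
    have hmem : y ∈ Submodule.span ℝ {T x} := by
      rw [span_T hx, ← hline, Equiv.apply_symm_apply]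
      exact Submodule.mem_span_singleton_self y
    obtain ⟨a, ha⟩ := Submodule.mem_span_singleton.1 hmem
    exact ⟨a • x, by rw [map_smul, ha]⟩
  refine ⟨LinearEquiv.ofBijective T ⟨hinj, hsurj⟩, fun M => ?_⟩
  obtain ⟨x, hx, rfl⟩ := exists_line M
  rw [← span_T hx]
  change Submodule.map _ (Submodule.span ℝ {x}) = _
  rw [Submodule.map_span, Set.image_singleton]
  rfl
end

section
/- Let X and Y be real normed spaces and let F(X) and F(Y) denote the families of all finite-dimensional linear subspaces of X and Y respectively, partially ordered by inclusion. If ρ : F(X) → F(Y) is an order isomorphism (a bijection with M ⊆ N iff ρ(M) ⊆ ρ(N)), then ρ maps the family M₁(X) of one-dimensional subspaces of X bijectively onto the family M₁(Y) of one-dimensional subspaces of Y, and this restriction preserves linear independence of finite collections in both directions: for every finite collection M₁, …, Mₙ ∈ M₁(X) and nonzero vectors xᵢ ∈ Mᵢ and yᵢ ∈ ρ(Mᵢ), the set {x₁, …, xₙ} is linearly independent if and only if {y₁, …, yₙ} is linearly independent. -/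
section

variable {K X Y : Type*} [Field K] [AddCommGroup X] [Module K X] [AddCommGroup Y] [Module K Y]

theorem Submodule.eq_span_singleton_of_finrank_eq_one {M : Submodule K X}
    (hM : Module.finrank K M = 1) {x : X} (hx : x ∈ M) (hx0 : x ≠ 0) :
    M = Submodule.span K {x} := by
  refine le_antisymm (fun z hz => ?_) ((Submodule.span_singleton_le_iff_mem x M).2 hx)
  obtain ⟨c, hc⟩ := exists_smul_eq_of_finrank_eq_one hM
    (x := (⟨x, hx⟩ : M)) (fun h => hx0 (congrArg Subtype.val h)) ⟨z, hz⟩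
  exact Submodule.mem_span_singleton.2 ⟨c, congrArg Subtype.val hc⟩

namespace OrderIso

variable (ρ : {M : Submodule K X // FiniteDimensional K M} ≃o
  {N : Submodule K Y // FiniteDimensional K N})

theorem finiteDimensional_submodule_apply_ne_bot
    {M : {M : Submodule K X // FiniteDimensional K M}} (hM : M.1 ≠ ⊥) : (ρ M).1 ≠ ⊥ := by
  intro h
  let B : {M : Submodule K X // FiniteDimensional K M} := ⟨⊥, inferInstance⟩
  have hle : ρ M ≤ ρ B := by
    change (ρ M).1 ≤ (ρ B).1
    rw [h]
    exact bot_le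
  exact hM (le_bot_iff.1 (ρ.le_iff_le.1 hle))

theorem finrank_finiteDimensional_submodule_apply_eq_one
    {M : {M : Submodule K X // FiniteDimensional K M}} (hM : Module.finrank K M.1 = 1) :
    Module.finrank K (ρ M).1 = 1 := by
  have hM0 : M.1 ≠ ⊥ := by
    intro h
    rw [h, finrank_bot] at hM
    exact zero_ne_one hM
  obtain ⟨v, hv, hv0⟩ :=
    Submodule.exists_mem_ne_zero_of_ne_bot (finiteDimensional_submodule_apply_ne_bot ρ hM0)
  let N : {N : Submodule K Y // FiniteDimensional K N} := ⟨Submodule.span K {v}, inferInstance⟩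
  have hN : N ≤ ρ M := (Submodule.span_singleton_le_iff_mem v _).2 hv
  have hN0 : N.1 ≠ ⊥ := mt Submodule.span_singleton_eq_bot.1 hv0
  obtain ⟨u, hu, hu0⟩ :=
    Submodule.exists_mem_ne_zero_of_ne_bot (finiteDimensional_submodule_apply_ne_bot ρ.symm hN0)
  have huM : u ∈ M.1 := (ρ.symm_apply_le.2 hN) hu
  have hMN : M ≤ ρ.symm N := by
    change M.1 ≤ (ρ.symm N).1
    rw [Submodule.eq_span_singleton_of_finrank_eq_one hM huM hu0]
    exact (Submodule.span_singleton_le_iff_mem u _).2 hu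
  rw [le_antisymm (ρ.le_symm_apply.1 hMN) hN]
  exact finrank_span_singleton hv0

theorem mem_span_image_of_mem_span_image {ι : Type*} [Finite ι]
    {M : ι → {M : Submodule K X // FiniteDimensional K M}} {x : ι → X} {y : ι → Y}
    (hx : ∀ i, (M i).1 = Submodule.span K {x i})
    (hy : ∀ i, (ρ (M i)).1 = Submodule.span K {y i}) {S : Set ι} {i : ι}
    (hi : x i ∈ Submodule.span K (x '' S)) : y i ∈ Submodule.span K (y '' S) := by
  let N : {N : Submodule K Y // FiniteDimensional K N} :=
    ⟨Submodule.span K (y '' S), FiniteDimensional.span_of_finite K (Set.toFinite _)⟩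
  have key : ∀ j, y j ∈ N.1 ↔ x j ∈ (ρ.symm N).1 := fun j => by
    rw [← Submodule.span_singleton_le_iff_mem, ← Submodule.span_singleton_le_iff_mem,
      ← hx, ← hy]
    exact ρ.le_symm_apply.symm
  refine (key i).2 (Submodule.span_le.2 ?_ hi)
  rintro _ ⟨j, hj, rfl⟩
  exact (key j).1 (Submodule.subset_span ⟨j, hj, rfl⟩)

end OrderIso

end


/-- An order isomorphism between the lattices of finite-dimensional subspaces restricts to
a bijection between the families of one-dimensional subspaces which preserves linear
independence of finite collections in both directions. -/
theorem order_iso_finite_dim_subspaces_preserves_lines_and_independence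
    {X Y : Type*} [NormedAddCommGroup X] [NormedSpace ℝ X]
    [NormedAddCommGroup Y] [NormedSpace ℝ Y]
    (ρ : {M : Submodule ℝ X // FiniteDimensional ℝ M} ≃o
         {N : Submodule ℝ Y // FiniteDimensional ℝ N}) :
    (∀ M : {M : Submodule ℝ X // FiniteDimensional ℝ M},
        Module.finrank ℝ M.1 = 1 → Module.finrank ℝ (ρ M).1 = 1) ∧
    (∀ N : {N : Submodule ℝ Y // FiniteDimensional ℝ N},
        Module.finrank ℝ N.1 = 1 → Module.finrank ℝ (ρ.symm N).1 = 1) ∧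
    (∀ (n : ℕ) (M : Fin n → {M : Submodule ℝ X // FiniteDimensional ℝ M}),
        (∀ i, Module.finrank ℝ (M i).1 = 1) →
        ∀ (x : Fin n → X) (y : Fin n → Y),
        (∀ i, x i ∈ (M i).1) → (∀ i, x i ≠ 0) →
        (∀ i, y i ∈ (ρ (M i)).1) → (∀ i, y i ≠ 0) →
        (LinearIndependent ℝ x ↔ LinearIndependent ℝ y)) := by
  refine ⟨fun M hM => ρ.finrank_finiteDimensional_submodule_apply_eq_one hM,
    fun N hN => ρ.symm.finrank_finiteDimensional_submodule_apply_eq_one hN, ?_⟩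
  intro n M hM x y hx hx0 hy hy0
  have hMx := fun i => Submodule.eq_span_singleton_of_finrank_eq_one (hM i) (hx i) (hx0 i)
  have hMy := fun i => Submodule.eq_span_singleton_of_finrank_eq_one
    (ρ.finrank_finiteDimensional_submodule_apply_eq_one (hM i)) (hy i) (hy0 i)
  rw [linearIndependent_iff_notMem_span, linearIndependent_iff_notMem_span]
  refine forall_congr' fun i => not_congr ⟨ρ.mem_span_image_of_mem_span_image hMx hMy, ?_⟩
  refine ρ.symm.mem_span_image_of_mem_span_image (M := fun i => ρ (M i)) hMy fun i => ?_
  rw [ρ.symm_apply_apply]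
  exact hMx i
end

section
/- Let X be a real Banach space and let x, y ∈ X. Then x ⊥⁺ y (i.e., ‖x + λy‖ ≥ ‖x‖ for all λ ≥ 0) if and only if there exists f ∈ ν(x) with f(y) ≥ 0. -/
/-- Birkhoff–James acute angle: `x ⊥⁺ y` iff `‖x + λ y‖ ≥ ‖x‖` for all `λ ≥ 0`. -/
def BJAcute {X : Type*} [NormedAddCommGroup X] [NormedSpace ℝ X] (x y : X) : Prop :=
  ∀ l : ℝ, 0 ≤ l → ‖x‖ ≤ ‖x + l • y‖

/-- A functional that stays below `u` on the open ball of radius `r` is controlled by the norm. -/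
theorem mul_le_mul_norm_of_forall_ball_lt {X : Type*} [NormedAddCommGroup X] [NormedSpace ℝ X]
    {f : X →L[ℝ] ℝ} {r u : ℝ} (hr : 0 < r) (h : ∀ z ∈ Metric.ball (0 : X) r, f z < u) (z : X) :
    f z * r ≤ u * ‖z‖ := by
  have hu : 0 < u := by simpa using h 0 (Metric.mem_ball_self hr)
  by_contra! hlt
  have hfz : 0 < f z := pos_of_mul_pos_left ((by positivity : 0 ≤ u * ‖z‖).trans_lt hlt) hr.le
  have hmem : (u / f z) • z ∈ Metric.ball (0 : X) r := by
    rw [mem_ball_zero_iff, norm_smul, Real.norm_of_nonneg (by positivity), div_mul_eq_mul_div,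
      div_lt_iff₀ hfz]
    linarith
  have hval := h _ hmem
  rw [map_smul, smul_eq_mul, div_mul_cancel₀ _ hfz.ne'] at hval
  exact hval.false

/-- The closed ray issuing from `x` in the direction `y` is convex. -/
theorem convex_image_add_smul_Ici {X : Type*} [AddCommGroup X] [Module ℝ X] (x y : X) :
    Convex ℝ ((fun l : ℝ => x + l • y) '' Set.Ici 0) := by
  have h := ((convex_Ici (0 : ℝ)).is_linear_image
    (IsLinearMap.isLinearMap_smul' y)).translate x
  rwa [Set.image_image] at h

/-- Characterization of the Birkhoff–James acute angle via supporting functionals. -/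
theorem bjAcute_iff_exists_supp_functional_nonneg
    {X : Type*} [NormedAddCommGroup X] [NormedSpace ℝ X] [CompleteSpace X] (x y : X) :
    BJAcute x y ↔ ∃ f : X →L[ℝ] ℝ, ‖f‖ ≤ 1 ∧ f x = ‖x‖ ∧ 0 ≤ f y := by
  constructor
  · intro h
    rcases eq_or_ne x 0 with rfl | hx
    · exact ⟨0, by simp⟩
    have hr : 0 < ‖x‖ := norm_pos_iff.mpr hx
    have hdisj : Disjoint (Metric.ball (0 : X) ‖x‖)
        ((fun l : ℝ => x + l • y) '' Set.Ici 0) := by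
      rw [Set.disjoint_right]
      rintro _ ⟨l, hl, rfl⟩ hmem
      exact (h l hl).not_gt (mem_ball_zero_iff.mp hmem)
    obtain ⟨f, u, hball, hray⟩ := geometric_hahn_banach_open (convex_ball (0 : X) ‖x‖)
      Metric.isOpen_ball (convex_image_add_smul_Ici x y) hdisj
    have hu : 0 < u := by simpa using hball 0 (Metric.mem_ball_self hr)
    have hbound := mul_le_mul_norm_of_forall_ball_lt hr hball
    have hfx : f x = u :=
      le_antisymm (le_of_mul_le_mul_right (hbound x) hr)
        (hray x ⟨0, Set.self_mem_Ici, by simp⟩)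
    have hfy : 0 ≤ f y := by
      have := hray (x + (1 : ℝ) • y) ⟨1, Set.mem_Ici.mpr zero_le_one, rfl⟩
      rw [one_smul, map_add] at this
      linarith
    refine ⟨(‖x‖ / u) • f, ContinuousLinearMap.opNorm_le_bound _ zero_le_one fun z => ?_, ?_, ?_⟩
    · have hneg := hbound (-z)
      rw [map_neg, norm_neg] at hneg
      have habs : |f z| * ‖x‖ ≤ u * ‖z‖ := by
        rcases abs_choice (f z) with hz | hz <;> rw [hz]
        exacts [hbound z, hneg]
      rw [smul_apply, norm_smul, Real.norm_of_nonneg (by positivity),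
        Real.norm_eq_abs, one_mul, div_mul_eq_mul_div, div_le_iff₀ hu]
      linarith
    · rw [smul_apply, hfx, smul_eq_mul, div_mul_cancel₀ _ hu.ne']
    · exact mul_nonneg (by positivity) hfy
  · rintro ⟨f, hf, hfx, hfy⟩ l hl
    calc ‖x‖ ≤ f (x + l • y) := by
          rw [map_add, map_smul, hfx, smul_eq_mul]
          exact le_add_of_nonneg_right (mul_nonneg hl hfy)
      _ ≤ ‖f (x + l • y)‖ := Real.le_norm_self _
      _ ≤ ‖x + l • y‖ := by simpa using f.le_of_opNorm_le hf (x + l • y)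
end

section
/- Let X be a real Banach space and let x, y ∈ X. Then x ⊥⁺⁺ y (i.e., x is at an acute angle to y but not Birkhoff–James orthogonal to y) if and only if f(y) > 0 for every f ∈ ν(x). -/
/-- Strictly acute angle: acute but not Birkhoff–James orthogonal. -/
def BJStrictlyAcute {X : Type*} [NormedAddCommGroup X] [NormedSpace ℝ X] (x y : X) : Prop :=
  BJAcute x y ∧ ¬ BJOrth x y

/-- James' theorem: Birkhoff–James orthogonality is witnessed by a supporting functional. -/
theorem BJOrth.exists_supp_functional_eq_zero {X : Type*} [NormedAddCommGroup X]
    [NormedSpace ℝ X] {x y : X} (h : BJOrth x y) :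
    ∃ f : X →L[ℝ] ℝ, ‖f‖ ≤ 1 ∧ f x = ‖x‖ ∧ f y = 0 := by
  let S : Submodule ℝ X := ℝ ∙ y
  obtain ⟨g, hg, hgx⟩ := exists_dual_vector'' ℝ (S.mkQ x)
  have hle (v : X) : ‖S.mkQ v‖ ≤ ‖v‖ := Submodule.Quotient.norm_mk_le S v
  have hx : ‖S.mkQ x‖ = ‖x‖ := by
    refine (hle x).antisymm (le_of_forall_pos_le_add fun ε hε => ?_)
    obtain ⟨m, hm, hlt⟩ := Submodule.Quotient.norm_mk_lt (S := S) (S.mkQ x) hε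
    obtain ⟨l, hl⟩ := Submodule.mem_span_singleton.1 ((Submodule.Quotient.eq S).1 hm)
    have hxl : x + l • y = m := by rw [hl]; abel
    exact (h l).trans (hxl ▸ hlt.le)
  refine ⟨(g.toLinearMap ∘ₗ S.mkQ).mkContinuous 1 fun v => ?_,
    LinearMap.mkContinuous_norm_le _ zero_le_one _, ?_, ?_⟩
  · calc ‖g (S.mkQ v)‖ ≤ 1 * ‖S.mkQ v‖ := g.le_of_opNorm_le hg _
      _ ≤ 1 * ‖v‖ := by gcongr; exact hle v
  · exact hgx.trans hx
  · have hy : S.mkQ y = 0 :=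
      (Submodule.Quotient.mk_eq_zero S).2 (Submodule.mem_span_singleton_self y)
    change g (S.mkQ y) = 0
    rw [hy, map_zero]

/-- Characterization of the strictly acute Birkhoff–James angle: all supporting
functionals are positive at `y`. -/
theorem bjStrictlyAcute_iff_forall_supp_functional_pos
    {X : Type*} [NormedAddCommGroup X] [NormedSpace ℝ X] [CompleteSpace X] (x y : X) :
    BJStrictlyAcute x y ↔
      ∀ f : X →L[ℝ] ℝ, ‖f‖ ≤ 1 → f x = ‖x‖ → 0 < f y := by
  have key (f : X →L[ℝ] ℝ) (hf : ‖f‖ ≤ 1) (l : ℝ) : f x + l * f y ≤ ‖x + l • y‖ := by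
    simpa using (le_abs_self _).trans (f.le_of_opNorm_le hf (x + l • y))
  constructor
  · rintro ⟨hacute, horth⟩ f hf hfx
    obtain ⟨l, hl⟩ := not_forall.1 horth
    have hl0 : l < 0 := not_le.1 fun h0 => hl (hacute l h0)
    have hlt := (key f hf l).trans_lt (not_le.1 hl)
    exact pos_of_mul_neg_right (by linarith) hl0.le
  · intro h
    refine ⟨fun l hl => ?_, fun horth => ?_⟩
    · obtain ⟨f, hf, hfx⟩ := exists_dual_vector'' ℝ x
      have hfx' : f x = ‖x‖ := hfx
      have hmul := mul_nonneg hl (h f hf hfx').le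
      linarith [key f hf l]
    · obtain ⟨f, hf, hfx, hfy⟩ := horth.exists_supp_functional_eq_zero
      exact (h f hf hfx).ne' hfy
end

section
/- Let X be a real Banach space and let x ∈ X be nonzero. Then the set R_x⁺⁺ = {y ∈ X : x ⊥⁺⁺ y} is open and convex, contains x, and is disjoint from R_x = {y ∈ X : x ⊥_BJ y}. -/
/-- `y` makes a strictly acute angle with `x` iff moving from `x` in the direction `-y`
strictly decreases the norm at some point. -/
theorem bjStrictlyAcute_iff_exists_norm_sub_lt
    {X : Type*} [NormedAddCommGroup X] [NormedSpace ℝ X] {x y : X} :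
    BJStrictlyAcute x y ↔ ∃ t : ℝ, 0 < t ∧ ‖x - t • y‖ < ‖x‖ := by
  constructor
  · rintro ⟨hacute, hnot⟩
    simp only [BJOrth, not_forall, not_le] at hnot
    obtain ⟨l, hl⟩ := hnot
    have hneg : l < 0 := by
      by_contra! h
      exact absurd (hacute l h) hl.not_ge
    exact ⟨-l, by linarith, by simpa [neg_smul, sub_neg_eq_add] using hl⟩
  · rintro ⟨t, ht, hlt⟩
    refine ⟨fun l hl => ?_, fun h => ?_⟩
    · have key : (t + l) • x = t • (x + l • y) + l • (x - t • y) := by module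
      have hle := norm_add_le (t • (x + l • y)) (l • (x - t • y))
      rw [← key, norm_smul_of_nonneg (by positivity), norm_smul_of_nonneg ht.le,
        norm_smul_of_nonneg hl] at hle
      have hmul := mul_le_mul_of_nonneg_left hlt.le hl
      exact le_of_mul_le_mul_left (by linarith) ht
    · have := h (-t)
      rw [neg_smul, ← sub_eq_add_neg] at this
      exact absurd this hlt.not_ge

theorem isOpen_setOf_bjStrictlyAcute
    {X : Type*} [NormedAddCommGroup X] [NormedSpace ℝ X] (x : X) :
    IsOpen {y : X | BJStrictlyAcute x y} := by
  simp only [bjStrictlyAcute_iff_exists_norm_sub_lt, Set.ofPred_exists, Set.ofPred_and]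
  exact isOpen_iUnion fun t => isOpen_const.inter (isOpen_lt (by fun_prop) (by fun_prop))

theorem convex_setOf_bjStrictlyAcute
    {X : Type*} [NormedAddCommGroup X] [NormedSpace ℝ X] (x : X) :
    Convex ℝ {y : X | BJStrictlyAcute x y} := by
  intro y hy z hz a b ha hb hab
  rw [Set.mem_ofPred_eq, bjStrictlyAcute_iff_exists_norm_sub_lt] at *
  obtain ⟨t, ht, hty⟩ := hy
  obtain ⟨s, hs, hsz⟩ := hz
  have hD : 0 < a * s + b * t := by
    rcases ha.eq_or_lt with rfl | ha
    · have : b = 1 := by linarith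
      subst this
      linarith
    · positivity
  refine ⟨t * s / (a * s + b * t), by positivity, ?_⟩
  have hcomb : x - (t * s / (a * s + b * t)) • (a • y + b • z) =
      (a * s / (a * s + b * t)) • (x - t • y) + (b * t / (a * s + b * t)) • (x - s • z) := by
    match_scalars <;> field_simp
  have hsum : a * s / (a * s + b * t) + b * t / (a * s + b * t) = 1 := by
    field_simp
  have hball := convex_ball (0 : X) ‖x‖ (mem_ball_zero_iff.2 hty) (mem_ball_zero_iff.2 hsz)
    (by positivity) (by positivity) hsum
  rwa [← hcomb, mem_ball_zero_iff] at hball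

/-- For nonzero `x`, the set `R_x⁺⁺` is open, convex, contains `x`, and is disjoint
from `R_x`. -/
theorem strictlyAcute_set_open_convex
    {X : Type*} [NormedAddCommGroup X] [NormedSpace ℝ X] [CompleteSpace X]
    (x : X) (hx : x ≠ 0) :
    IsOpen {y : X | BJStrictlyAcute x y} ∧
    Convex ℝ {y : X | BJStrictlyAcute x y} ∧
    x ∈ {y : X | BJStrictlyAcute x y} ∧
    {y : X | BJStrictlyAcute x y} ∩ {y : X | BJOrth x y} = ∅ := by
  refine ⟨isOpen_setOf_bjStrictlyAcute x, convex_setOf_bjStrictlyAcute x,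
    bjStrictlyAcute_iff_exists_norm_sub_lt.2 ⟨1, one_pos, by simpa using hx⟩, ?_⟩
  exact Set.eq_empty_of_forall_notMem fun y hy => hy.1.2 hy.2
end

section
/- Let X be a real Banach space, let x ∈ X be nonzero, and let A be a connected subset of X with x ∈ A and A ∩ R_x = ∅, where R_x = {y ∈ X : x ⊥_BJ y}. Then A ⊆ R_x⁺⁺ = {y ∈ X : x ⊥⁺⁺ y}. -/
/-- By convexity of the norm, the norm cannot decrease from `x` in both directions `y`, `-y`. -/
theorem norm_le_add_smul_of_neg_of_pos {X : Type*} [NormedAddCommGroup X] [NormedSpace ℝ X]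
    {x y : X} {l m : ℝ} (hl : l < 0) (h : ‖x + l • y‖ < ‖x‖) (hm : 0 < m) :
    ‖x‖ ≤ ‖x + m • y‖ := by
  by_contra! h'
  have key : (m - l) • x = m • (x + l • y) + (-l) • (x + m • y) := by module
  have hn : (m - l) * ‖x‖ ≤ m * ‖x + l • y‖ + (-l) * ‖x + m • y‖ := by
    calc (m - l) * ‖x‖ = ‖(m - l) • x‖ := by rw [norm_smul_of_nonneg (by linarith)]
      _ ≤ ‖m • (x + l • y)‖ + ‖(-l) • (x + m • y)‖ := key ▸ norm_add_le _ _
      _ = _ := by rw [norm_smul_of_nonneg hm.le, norm_smul_of_nonneg (by linarith)]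
  nlinarith [mul_pos hm (sub_pos.2 h), mul_pos (neg_pos.2 hl) (sub_pos.2 h')]

/-- The directions along which some step with parameter in `S` decreases the norm of `x`
form an open set. -/
theorem isOpen_setOf_exists_norm_add_smul_lt {X : Type*} [NormedAddCommGroup X] [NormedSpace ℝ X]
    (x : X) (S : Set ℝ) : IsOpen {y : X | ∃ l ∈ S, ‖x + l • y‖ < ‖x‖} := by
  have : {y : X | ∃ l ∈ S, ‖x + l • y‖ < ‖x‖} = ⋃ l ∈ S, {y : X | ‖x + l • y‖ < ‖x‖} := by
    ext y
    simp
  rw [this]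
  exact isOpen_biUnion fun l _ => isOpen_lt (by fun_prop) continuous_const

/-- A connected subset of `X \ R_x` containing `x` is contained in `R_x⁺⁺`. -/
theorem connected_avoiding_orth_subset_strictlyAcute
    {X : Type*} [NormedAddCommGroup X] [NormedSpace ℝ X] [CompleteSpace X]
    (x : X) (hx : x ≠ 0) (A : Set X) (hA : IsPreconnected A) (hxA : x ∈ A)
    (hdisj : A ∩ {y : X | BJOrth x y} = ∅) :
    A ⊆ {y : X | BJStrictlyAcute x y} := by
  have hnot : ∀ y ∈ A, ¬ BJOrth x y := fun y hy h =>
    Set.eq_empty_iff_forall_notMem.1 hdisj y ⟨hy, h⟩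
  intro y hy
  refine ⟨fun l hl => ?_, hnot y hy⟩
  by_contra! hlt
  have hl0 : 0 < l := by
    refine hl.lt_of_ne ?_
    rintro rfl
    simp at hlt
  obtain ⟨z, -, ⟨a, ha, hza⟩, ⟨b, hb, hzb⟩⟩ := hA _ _
    (isOpen_setOf_exists_norm_add_smul_lt x (Set.Iio 0))
    (isOpen_setOf_exists_norm_add_smul_lt x (Set.Ioi 0))
    (fun w hw => by
      obtain ⟨c, hc⟩ := not_forall.1 (hnot w hw)
      rw [not_le] at hc
      rcases lt_trichotomy c 0 with h | rfl | h
      · exact Or.inl ⟨c, h, hc⟩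
      · simp at hc
      · exact Or.inr ⟨c, h, hc⟩)
    ⟨x, hxA, -1, by simp, by simpa using hx⟩ ⟨y, hy, l, hl0, hlt⟩
  exact hzb.not_ge (norm_le_add_smul_of_neg_of_pos ha hza hb)
end

section
/- Let X and Y be real Banach spaces and let T : X → Y be a continuous Birkhoff–James orthogonality preserver. Then for all x, y ∈ X, x ⊥⁺ y implies T(x) ⊥⁺ T(y). -/
/-- The directions `w` along which the norm strictly decreases when moving from `u` along `-w`. -/
def ascentCone {X : Type*} [NormedAddCommGroup X] [NormedSpace ℝ X] (u : X) : Set X :=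
  {w | ∃ s : ℝ, ‖s • u - w‖ < s * ‖u‖}

section AscentCone

variable {X : Type*} [NormedAddCommGroup X] [NormedSpace ℝ X]

theorem bjAcute_iff_neg_notMem_ascentCone (u w : X) : BJAcute u w ↔ -w ∉ ascentCone u := by
  constructor
  · rintro h ⟨s, hs⟩
    have hpos : 0 < s := pos_of_mul_pos_left ((norm_nonneg _).trans_lt hs) (norm_nonneg _)
    have heq : s • u - -w = s • (u + s⁻¹ • w) := by
      rw [smul_add, smul_inv_smul₀ hpos.ne', sub_neg_eq_add]
    rw [heq, norm_smul, Real.norm_of_nonneg hpos.le] at hs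
    exact absurd (h s⁻¹ (inv_pos.2 hpos).le) (not_le.2 (lt_of_mul_lt_mul_left hs hpos.le))
  · intro h l hl
    by_contra! hlt
    rcases hl.eq_or_lt with rfl | hl
    · simp at hlt
    refine h ⟨l⁻¹, ?_⟩
    have heq : l⁻¹ • u - -w = l⁻¹ • (u + l • w) := by
      rw [smul_add, inv_smul_smul₀ hl.ne', sub_neg_eq_add]
    rw [heq, norm_smul, Real.norm_of_nonneg (inv_pos.2 hl).le]
    exact mul_lt_mul_of_pos_left hlt (inv_pos.2 hl)

theorem bjOrth_iff_bjAcute_and_neg (u w : X) : BJOrth u w ↔ BJAcute u w ∧ BJAcute u (-w) := by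
  constructor
  · exact fun h ↦ ⟨fun l _ ↦ h l, fun l _ ↦ by simpa using h (-l)⟩
  · rintro ⟨h₁, h₂⟩ l
    rcases le_total 0 l with hl | hl
    · exact h₁ l hl
    · simpa using h₂ (-l) (neg_nonneg.2 hl)

theorem bjOrth_iff_notMem_ascentCone (u w : X) :
    BJOrth u w ↔ w ∉ ascentCone u ∧ -w ∉ ascentCone u := by
  rw [bjOrth_iff_bjAcute_and_neg, bjAcute_iff_neg_notMem_ascentCone,
    bjAcute_iff_neg_notMem_ascentCone, neg_neg, and_comm]

theorem isOpen_ascentCone (u : X) : IsOpen (ascentCone u) := by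
  simp only [ascentCone, Set.ofPred_exists]
  exact isOpen_iUnion fun s ↦ isOpen_lt (by fun_prop) continuous_const

theorem convex_ascentCone (u : X) : Convex ℝ (ascentCone u) := by
  rw [convex_iff_forall_pos]
  rintro v ⟨s, hs⟩ w ⟨r, hr⟩ a b ha hb -
  refine ⟨a * s + b * r, ?_⟩
  have heq : (a * s + b * r) • u - (a • v + b • w) = a • (s • u - v) + b • (r • u - w) := by
    module
  calc ‖(a * s + b * r) • u - (a • v + b • w)‖
      ≤ a * ‖s • u - v‖ + b * ‖r • u - w‖ := by
        rw [heq]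
        refine (norm_add_le _ _).trans_eq ?_
        rw [norm_smul, norm_smul, Real.norm_of_nonneg ha.le, Real.norm_of_nonneg hb.le]
    _ < a * (s * ‖u‖) + b * (r * ‖u‖) := by gcongr
    _ = (a * s + b * r) * ‖u‖ := by ring

theorem neg_notMem_ascentCone {u w : X} (h : w ∈ ascentCone u) : -w ∉ ascentCone u := by
  rintro ⟨r, hr⟩
  obtain ⟨s, hs⟩ := h
  have heq : (s + r) • u = (s • u - w) + (r • u - -w) := by module
  have hle : (s + r) * ‖u‖ ≤ ‖(s + r) • u‖ := by
    rw [norm_smul]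
    exact mul_le_mul_of_nonneg_right (le_abs_self _) (norm_nonneg _)
  rw [heq] at hle
  linarith [norm_add_le (s • u - w) (r • u - -w)]

theorem self_mem_ascentCone {u : X} (hu : u ≠ 0) : u ∈ ascentCone u :=
  ⟨1, by simpa using hu⟩

end AscentCone

/-- A continuous map preserving the failure of Birkhoff–James orthogonality maps the connected
component of `x` in the complement of `x^⊥` into that of `T x`. -/
theorem mapsTo_ascentCone {X Y : Type*} [NormedAddCommGroup X] [NormedSpace ℝ X]
    [NormedAddCommGroup Y] [NormedSpace ℝ Y] {T : X → Y} (hcont : Continuous T)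
    (hbj : ∀ x y : X, BJOrth (T x) (T y) → BJOrth x y) {x : X} (hx : x ≠ 0) :
    Set.MapsTo T (ascentCone x) (ascentCone (T x)) := by
  have hself := self_mem_ascentCone hx
  have hcover {y : X} (hy : y ∈ ascentCone x) :
      T y ∈ ascentCone (T x) ∨ -T y ∈ ascentCone (T x) := by
    by_contra! h
    exact ((bjOrth_iff_notMem_ascentCone x y).1
      (hbj x y ((bjOrth_iff_notMem_ascentCone _ _).2 h))).1 hy
  have hTx : T x ≠ 0 := by
    intro h0
    exact ((bjOrth_iff_notMem_ascentCone x x).1 (hbj x x (by simp [BJOrth, h0]))).1 hself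
  have hsub : T '' ascentCone x ⊆ ascentCone (T x) :=
    ((convex_ascentCone x).isPreconnected.image T hcont.continuousOn).subset_left_of_subset_union
      (isOpen_ascentCone _) ((isOpen_ascentCone (T x)).preimage continuous_neg)
      (Set.disjoint_left.2 fun _ ↦ neg_notMem_ascentCone)
      (Set.image_subset_iff.2 fun _ ↦ hcover)
      ⟨T x, Set.mem_image_of_mem T hself, self_mem_ascentCone hTx⟩
  exact Set.mapsTo_iff_image_subset.2 hsub

/-- A continuous Birkhoff–James orthogonality preserver preserves the Birkhoff–James
acute angle (in the forward direction). -/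
theorem continuous_bj_preserver_preserves_acute
    {X Y : Type*} [NormedAddCommGroup X] [NormedSpace ℝ X] [CompleteSpace X]
    [NormedAddCommGroup Y] [NormedSpace ℝ Y] [CompleteSpace Y]
    (T : X → Y) (hcont : Continuous T) (hbij : Function.Bijective T)
    (hbj : ∀ x y : X, BJOrth x y ↔ BJOrth (T x) (T y)) :
    ∀ x y : X, BJAcute x y → BJAcute (T x) (T y) := by
  intro x y hxy
  rcases eq_or_ne x 0 with rfl | hx
  · have h0 : BJOrth (T 0) (T y) := (hbj 0 y).1 fun l ↦ by simp
    exact fun l _ ↦ h0 l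
  by_cases hy : y ∈ ascentCone x
  · exact (bjAcute_iff_neg_notMem_ascentCone _ _).2
      (neg_notMem_ascentCone (mapsTo_ascentCone hcont (fun x y ↦ (hbj x y).2) hx hy))
  · have hxy' := (bjAcute_iff_neg_notMem_ascentCone x y).1 hxy
    have h := (hbj x y).1 ((bjOrth_iff_notMem_ascentCone x y).2 ⟨hy, hxy'⟩)
    exact fun l _ ↦ h l
end

section
/- Let X be a real Banach space and let x, y ∈ X. Then x ⊥⁺ y if and only if there exists a sequence (λₙ) of positive real numbers with λₙ → 0 and ‖x + λₙ y‖ ≥ ‖x‖ for every n. -/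
/-- `x ⊥⁺ y` iff there is a sequence of positive reals tending to `0` along which the
norm inequality holds. -/
theorem bjAcute_iff_exists_pos_seq
    {X : Type*} [NormedAddCommGroup X] [NormedSpace ℝ X] [CompleteSpace X] (x y : X) :
    BJAcute x y ↔ ∃ l : ℕ → ℝ, (∀ n, 0 < l n) ∧
      Filter.Tendsto l Filter.atTop (nhds 0) ∧ ∀ n, ‖x‖ ≤ ‖x + l n • y‖ := by
  refine ⟨fun h ↦ ⟨fun n ↦ 1 / ((n : ℝ) + 1), fun n ↦ by positivity,
    tendsto_one_div_add_atTop_nhds_zero_nat, fun n ↦ h _ (by positivity)⟩, ?_⟩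
  rintro ⟨l, l_pos, l_lim, l_le⟩ m hm
  rcases hm.eq_or_lt with rfl | hm
  · simp
  obtain ⟨n, hn⟩ := (l_lim.eventually_lt_const hm).exists
  have ht : 0 < l n / m := div_pos (l_pos n) hm
  have ht1 : 0 ≤ 1 - l n / m := sub_nonneg.2 ((div_le_one hm).2 hn.le)
  have key : x + l n • y = (1 - l n / m) • x + (l n / m) • (x + m • y) := by
    rw [smul_add, smul_smul, div_mul_cancel₀ _ hm.ne', sub_smul, one_smul]
    abel
  have bound : ‖x‖ ≤ (1 - l n / m) * ‖x‖ + l n / m * ‖x + m • y‖ :=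
    calc ‖x‖ ≤ ‖x + l n • y‖ := l_le n
      _ = ‖(1 - l n / m) • x + (l n / m) • (x + m • y)‖ := by rw [key]
      _ ≤ _ := (norm_add_le _ _).trans_eq (by
        rw [norm_smul_of_nonneg ht1, norm_smul_of_nonneg ht.le])
  exact le_of_mul_le_mul_left (by linarith) ht
end

section
/- Let X and Y be real Banach spaces and let (x₁, y₁), (x₂, y₂) ∈ X ⊕_∞ Y. Then (x₁, y₁) ⊥⁺ (x₂, y₂) in X ⊕_∞ Y if and only if one of the following holds: (i) ‖x₁‖ > ‖y₁‖ and x₁ ⊥⁺ x₂; (ii) ‖x₁‖ = ‖y₁‖ and (x₁ ⊥⁺ x₂ or y₁ ⊥⁺ y₂); (iii) ‖x₁‖ < ‖y₁‖ and y₁ ⊥⁺ y₂. -/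
open Filter Topology in
/-- By convexity of the norm, if `x ⊥⁺ y` fails then `‖x + l y‖ < ‖x‖` for all small `l > 0`. -/
lemma eventually_norm_add_smul_lt_of_not_bjAcute {X : Type*} [NormedAddCommGroup X]
    [NormedSpace ℝ X] {x y : X} (h : ¬ BJAcute x y) :
    ∀ᶠ l : ℝ in 𝓝[>] 0, ‖x + l • y‖ < ‖x‖ := by
  simp only [BJAcute, not_forall, not_le] at h
  obtain ⟨m, hm, hlt⟩ := h
  have hm0 : 0 < m := by
    refine hm.lt_of_ne ?_
    rintro rfl
    simp at hlt
  filter_upwards [Ioo_mem_nhdsGT hm0] with l hl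
  have ht0 : 0 < l / m := div_pos hl.1 hm0
  have ht1 : 0 ≤ 1 - l / m := sub_nonneg.2 ((div_le_one hm0).2 hl.2.le)
  calc ‖x + l • y‖ = ‖(1 - l / m) • x + (l / m) • (x + m • y)‖ := by
        rw [smul_add, smul_smul, div_mul_cancel₀ _ hm0.ne', ← add_assoc, ← add_smul,
          sub_add_cancel, one_smul]
    _ ≤ (1 - l / m) * ‖x‖ + (l / m) * ‖x + m • y‖ := by
        refine (norm_add_le _ _).trans_eq ?_
        rw [norm_smul_of_nonneg ht1, norm_smul_of_nonneg ht0.le]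
    _ < (1 - l / m) * ‖x‖ + (l / m) * ‖x‖ := by gcongr
    _ = ‖x‖ := by ring

open Filter Topology in
lemma eventually_norm_add_smul_lt {X : Type*} [NormedAddCommGroup X] [NormedSpace ℝ X]
    {x : X} (y : X) {c : ℝ} (h : ‖x‖ < c) :
    ∀ᶠ l : ℝ in 𝓝[>] 0, ‖x + l • y‖ < c := by
  have hc : Continuous fun l : ℝ => ‖x + l • y‖ := by fun_prop
  exact nhdsWithin_le_nhds (hc.continuousAt.eventually_lt_const (by simpa using h))

open Filter Topology in
lemma not_bjAcute_prod {X Y : Type*} [NormedAddCommGroup X] [NormedSpace ℝ X]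
    [NormedAddCommGroup Y] [NormedSpace ℝ Y] {x₁ x₂ : X} {y₁ y₂ : Y}
    (hx : ∀ᶠ l : ℝ in 𝓝[>] 0, ‖x₁ + l • x₂‖ < max ‖x₁‖ ‖y₁‖)
    (hy : ∀ᶠ l : ℝ in 𝓝[>] 0, ‖y₁ + l • y₂‖ < max ‖x₁‖ ‖y₁‖) :
    ¬ BJAcute (X := X × Y) (x₁, y₁) (x₂, y₂) := by
  intro h
  obtain ⟨l, ⟨hlx, hly⟩, hl⟩ := ((hx.and hy).and self_mem_nhdsWithin).exists
  exact (h l (le_of_lt hl)).not_gt (max_lt hlx hly)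

lemma BJAcute.prod_left {X Y : Type*} [NormedAddCommGroup X] [NormedSpace ℝ X]
    [NormedAddCommGroup Y] [NormedSpace ℝ Y] {x₁ x₂ : X} {y₁ : Y} (h : BJAcute x₁ x₂)
    (hle : ‖y₁‖ ≤ ‖x₁‖) (y₂ : Y) : BJAcute (X := X × Y) (x₁, y₁) (x₂, y₂) :=
  fun l hl => (max_le le_rfl hle).trans ((h l hl).trans (le_max_left _ _))

lemma BJAcute.prod_right {X Y : Type*} [NormedAddCommGroup X] [NormedSpace ℝ X]
    [NormedAddCommGroup Y] [NormedSpace ℝ Y] {x₁ : X} {y₁ y₂ : Y} (h : BJAcute y₁ y₂)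
    (hle : ‖x₁‖ ≤ ‖y₁‖) (x₂ : X) : BJAcute (X := X × Y) (x₁, y₁) (x₂, y₂) :=
  fun l hl => (max_le hle le_rfl).trans ((h l hl).trans (le_max_right _ _))

/-- Characterization of the Birkhoff–James acute angle in an `∞`-direct sum
`X ⊕_∞ Y` (realized as `X × Y` with the max norm). -/
theorem bjAcute_prod_iff
    {X Y : Type*} [NormedAddCommGroup X] [NormedSpace ℝ X] [CompleteSpace X]
    [NormedAddCommGroup Y] [NormedSpace ℝ Y] [CompleteSpace Y]
    (x₁ x₂ : X) (y₁ y₂ : Y) :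
    BJAcute (X := X × Y) (x₁, y₁) (x₂, y₂) ↔
      (‖y₁‖ < ‖x₁‖ ∧ BJAcute x₁ x₂) ∨
      (‖x₁‖ = ‖y₁‖ ∧ (BJAcute x₁ x₂ ∨ BJAcute y₁ y₂)) ∨
      (‖x₁‖ < ‖y₁‖ ∧ BJAcute y₁ y₂) := by
  constructor
  · intro h
    rcases lt_trichotomy ‖x₁‖ ‖y₁‖ with hlt | heq | hgt
    · refine Or.inr (Or.inr ⟨hlt, ?_⟩)
      by_contra hy
      refine not_bjAcute_prod ?_ ?_ h <;> rw [max_eq_right hlt.le]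
      · exact eventually_norm_add_smul_lt x₂ hlt
      · exact eventually_norm_add_smul_lt_of_not_bjAcute hy
    · refine Or.inr (Or.inl ⟨heq, ?_⟩)
      by_contra! hxy
      refine not_bjAcute_prod ?_ ?_ h
      · rw [max_eq_left heq.ge]
        exact eventually_norm_add_smul_lt_of_not_bjAcute hxy.1
      · rw [max_eq_right heq.le]
        exact eventually_norm_add_smul_lt_of_not_bjAcute hxy.2
    · refine Or.inl ⟨hgt, ?_⟩
      by_contra hx
      refine not_bjAcute_prod ?_ ?_ h <;> rw [max_eq_left hgt.le]
      · exact eventually_norm_add_smul_lt_of_not_bjAcute hx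
      · exact eventually_norm_add_smul_lt y₂ hgt
  · rintro (⟨hlt, hx⟩ | ⟨heq, hx | hy⟩ | ⟨hlt, hy⟩)
    · exact hx.prod_left hlt.le y₂
    · exact hx.prod_left heq.ge y₂
    · exact hy.prod_right heq.le x₂
    · exact hy.prod_right hlt.le x₂
end

section
/- Let X, Y, Z, W be real Banach spaces such that X =_BJ Z and Y =_BJ W. Then X ⊕_∞ Y =_BJ Z ⊕_∞ W. -/
/-- `X =_BJ Y`: there is a norm-preserving homogeneous homeomorphism between `X` and `Y`
preserving Birkhoff–James orthogonality in both directions. -/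
def BJStrongIso (X Y : Type*) [NormedAddCommGroup X] [NormedSpace ℝ X]
    [NormedAddCommGroup Y] [NormedSpace ℝ Y] : Prop :=
  ∃ T : X ≃ₜ Y, (∀ x : X, ‖T x‖ = ‖x‖) ∧ (∀ (c : ℝ) (x : X), T (c • x) = c • T x) ∧
    ∀ x y : X, BJOrth x y ↔ BJOrth (T x) (T y)

open Filter Topology

/-- The directions in which the norm strictly decreases when starting at `x`. -/
def decreasingDirections {X : Type*} [NormedAddCommGroup X] [NormedSpace ℝ X] (x : X) : Set X :=
  {u | ∃ l : ℝ, 0 < l ∧ ‖x + l • u‖ < ‖x‖}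

section DecreasingDirections

variable {X Y : Type*} [NormedAddCommGroup X] [NormedSpace ℝ X]
  [NormedAddCommGroup Y] [NormedSpace ℝ Y]

theorem norm_add_smul_lt_of_le {x u : X} {l m : ℝ} (hm : 0 < m) (hml : m ≤ l)
    (h : ‖x + l • u‖ < ‖x‖) : ‖x + m • u‖ < ‖x‖ := by
  have hl : 0 < l := hm.trans_le hml
  have hq : 0 < m / l := div_pos hm hl
  have hq1 : 0 ≤ 1 - m / l := sub_nonneg.2 ((div_le_one hl).2 hml)
  have key : x + m • u = (1 - m / l) • x + (m / l) • (x + l • u) := by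
    rw [smul_add, smul_smul, div_mul_cancel₀ _ hl.ne']
    module
  calc ‖x + m • u‖ ≤ (1 - m / l) * ‖x‖ + m / l * ‖x + l • u‖ := by
        rw [key]
        refine (norm_add_le _ _).trans_eq ?_
        rw [norm_smul_of_nonneg hq1, norm_smul_of_nonneg hq.le]
    _ < (1 - m / l) * ‖x‖ + m / l * ‖x‖ := by gcongr
    _ = ‖x‖ := by ring

theorem eventually_norm_add_smul_lt_s15 {x u : X} (h : u ∈ decreasingDirections x) :
    ∀ᶠ m in 𝓝[>] (0 : ℝ), ‖x + m • u‖ < ‖x‖ := by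
  obtain ⟨l, hl, h⟩ := h
  filter_upwards [Ioc_mem_nhdsGT hl] with m hm
  exact norm_add_smul_lt_of_le hm.1 hm.2 h

theorem convex_decreasingDirections (x : X) : Convex ℝ (decreasingDirections x) := by
  intro u hu v hv a b ha hb hab
  obtain ⟨m, ⟨hu, hv⟩, hm⟩ := ((eventually_norm_add_smul_lt_s15 hu).and
    (eventually_norm_add_smul_lt_s15 hv)).and self_mem_nhdsWithin |>.exists
  refine ⟨m, hm, ?_⟩
  have key : x + m • (a • u + b • v) = a • (x + m • u) + b • (x + m • v) := by
    obtain rfl : a = 1 - b := by linarith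
    module
  have := convex_ball (0 : X) ‖x‖ (mem_ball_zero_iff.2 hu) (mem_ball_zero_iff.2 hv) ha hb hab
  rwa [key, ← mem_ball_zero_iff]

theorem isOpen_decreasingDirections (x : X) : IsOpen (decreasingDirections x) := by
  have : decreasingDirections x = ⋃ l : ℝ, ⋃ _ : 0 < l, {u | ‖x + l • u‖ < ‖x‖} := by
    ext u
    simp [decreasingDirections]
  rw [this]
  exact isOpen_iUnion fun l ↦ isOpen_iUnion fun _ ↦ isOpen_lt (by fun_prop) (by fun_prop)

theorem neg_notMem_decreasingDirections {x u : X} (hu : u ∈ decreasingDirections x) :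
    -u ∉ decreasingDirections x := by
  intro hv
  have := convex_decreasingDirections x hu hv (a := 1 / 2) (b := 1 / 2)
    (by norm_num) (by norm_num) (by norm_num)
  obtain ⟨l, -, h⟩ := this
  simp at h

theorem neg_self_mem_decreasingDirections {x : X} (hx : x ≠ 0) :
    -x ∈ decreasingDirections x :=
  ⟨1, one_pos, by simpa using hx⟩

theorem ne_zero_of_mem_decreasingDirections {x u : X} (hu : u ∈ decreasingDirections x) :
    x ≠ 0 := by
  obtain ⟨l, -, h⟩ := hu
  exact norm_pos_iff.1 ((norm_nonneg _).trans_lt h)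

theorem not_bjOrth_iff {x u : X} :
    ¬ BJOrth x u ↔ u ∈ decreasingDirections x ∨ -u ∈ decreasingDirections x := by
  simp only [BJOrth, not_forall, not_le]
  constructor
  · rintro ⟨l, hl⟩
    rcases lt_trichotomy l 0 with h | rfl | h
    · exact Or.inr ⟨-l, neg_pos.2 h, by simpa using hl⟩
    · simp at hl
    · exact Or.inl ⟨l, h, hl⟩
  · rintro (⟨l, -, hl⟩ | ⟨l, -, hl⟩)
    · exact ⟨l, hl⟩
    · exact ⟨-l, by simpa using hl⟩

theorem map_mem_decreasingDirections {T : X → Y} (hT : Continuous T)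
    (hsmul : ∀ (c : ℝ) (x : X), T (c • x) = c • T x)
    {x : X} (hx : T x ≠ 0) (horth : ∀ u, BJOrth x u ↔ BJOrth (T x) (T u)) {u : X} :
    T u ∈ decreasingDirections (T x) ↔ u ∈ decreasingDirections x := by
  have hneg (v : X) : T (-v) = -T v := by simpa using hsmul (-1) v
  have key {v : X} (hv : v ∈ decreasingDirections x) : T v ∈ decreasingDirections (T x) := by
    have hsub : T '' decreasingDirections x ⊆ decreasingDirections (T x) := by
      refine IsPreconnected.subset_left_of_subset_union (isOpen_decreasingDirections (T x))
        (isOpen_decreasingDirections (T x)).neg ?_ ?_ ?_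
        ((convex_decreasingDirections x).isPreconnected.image T hT.continuousOn)
      · exact Set.disjoint_left.2 fun w hw ↦ neg_notMem_decreasingDirections hw
      · rintro _ ⟨w, hw, rfl⟩
        exact not_bjOrth_iff.1 ((horth w).not.1 (not_bjOrth_iff.2 (Or.inl hw)))
      · refine ⟨-T x, ⟨-x, neg_self_mem_decreasingDirections
          (ne_zero_of_mem_decreasingDirections hv), hneg x⟩,
          neg_self_mem_decreasingDirections hx⟩
    exact hsub ⟨v, hv, rfl⟩
  refine ⟨fun hu ↦ ?_, key⟩
  refine (not_bjOrth_iff.1 ((horth u).not.2 (not_bjOrth_iff.2 (Or.inl hu)))).resolve_right ?_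
  intro h
  exact neg_notMem_decreasingDirections hu (hneg u ▸ key h)

theorem eventually_norm_add_smul_lt_of_le {x u : X} {R : ℝ}
    (h : R ≤ ‖x‖ → u ∈ decreasingDirections x) (hR : ‖x‖ ≤ R) :
    ∀ᶠ m in 𝓝[>] (0 : ℝ), ‖x + m • u‖ < R := by
  rcases hR.lt_or_eq with hlt | rfl
  · have hc : Continuous fun m : ℝ ↦ ‖x + m • u‖ := by fun_prop
    exact nhdsWithin_le_nhds (hc.continuousAt.eventually_lt continuousAt_const (by simpa))
  · exact eventually_norm_add_smul_lt_s15 (h le_rfl)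

theorem mem_decreasingDirections_prod {p q : X × Y} :
    q ∈ decreasingDirections p ↔
      (‖p.2‖ ≤ ‖p.1‖ → q.1 ∈ decreasingDirections p.1) ∧
      (‖p.1‖ ≤ ‖p.2‖ → q.2 ∈ decreasingDirections p.2) := by
  constructor
  · rintro ⟨l, hl, h⟩
    simp only [Prod.norm_def, Prod.fst_add, Prod.snd_add, Prod.smul_fst, Prod.smul_snd,
      max_lt_iff] at h
    exact ⟨fun hp ↦ ⟨l, hl, by simpa [max_eq_left hp] using h.1⟩,
      fun hp ↦ ⟨l, hl, by simpa [max_eq_right hp] using h.2⟩⟩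
  · rintro ⟨h1, h2⟩
    obtain ⟨m, ⟨hu, hv⟩, hm⟩ := ((eventually_norm_add_smul_lt_of_le (R := ‖p‖)
      (fun h ↦ h1 ((norm_snd_le p).trans h)) (norm_fst_le p)).and
      (eventually_norm_add_smul_lt_of_le (R := ‖p‖)
      (fun h ↦ h2 ((norm_fst_le p).trans h)) (norm_snd_le p))).and
      self_mem_nhdsWithin |>.exists
    exact ⟨m, hm, max_lt hu hv⟩

theorem map_mem_decreasingDirections_of_norm_eq {T : X → Y} (hT : Continuous T)
    (hnorm : ∀ x, ‖T x‖ = ‖x‖) (hsmul : ∀ (c : ℝ) (x : X), T (c • x) = c • T x)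
    (horth : ∀ x u, BJOrth x u ↔ BJOrth (T x) (T u)) (x u : X) :
    T u ∈ decreasingDirections (T x) ↔ u ∈ decreasingDirections x := by
  have h0 : T x = 0 ↔ x = 0 := by rw [← norm_eq_zero, hnorm, norm_eq_zero]
  by_cases hx : x = 0
  · exact ⟨fun h ↦ (ne_zero_of_mem_decreasingDirections h (h0.2 hx)).elim,
      fun h ↦ (ne_zero_of_mem_decreasingDirections h hx).elim⟩
  · exact map_mem_decreasingDirections hT hsmul (h0.not.2 hx) (horth x)

end DecreasingDirections


/-- Strong Birkhoff–James isomorphism passes to `∞`-direct sums (realized as products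
with the max norm). -/
theorem bjStrongIso_prod
    {X Y Z W : Type*} [NormedAddCommGroup X] [NormedSpace ℝ X] [CompleteSpace X]
    [NormedAddCommGroup Y] [NormedSpace ℝ Y] [CompleteSpace Y]
    [NormedAddCommGroup Z] [NormedSpace ℝ Z] [CompleteSpace Z]
    [NormedAddCommGroup W] [NormedSpace ℝ W] [CompleteSpace W]
    (hXZ : BJStrongIso X Z) (hYW : BJStrongIso Y W) :
    BJStrongIso (X × Y) (Z × W) := by
  obtain ⟨T, hTn, hTs, hTo⟩ := hXZ
  obtain ⟨S, hSn, hSs, hSo⟩ := hYW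
  have hsmul (c : ℝ) (p : X × Y) : T.prodCongr S (c • p) = c • T.prodCongr S p :=
    Prod.ext (hTs c p.1) (hSs c p.2)
  have hmem (p q : X × Y) : T.prodCongr S q ∈ decreasingDirections (T.prodCongr S p) ↔
      q ∈ decreasingDirections p := by
    simp [mem_decreasingDirections_prod, hTn, hSn,
      map_mem_decreasingDirections_of_norm_eq T.continuous hTn hTs hTo,
      map_mem_decreasingDirections_of_norm_eq S.continuous hSn hSs hSo]
  refine ⟨T.prodCongr S, fun p ↦ ?_, hsmul, fun p q ↦ ?_⟩
  · simp [Prod.norm_def, hTn, hSn]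
  · rw [← not_iff_not, not_bjOrth_iff, not_bjOrth_iff, ← hmem p q, ← hmem p (-q)]
    have hneg : T.prodCongr S (-q) = -T.prodCongr S q := by simpa using hsmul (-1) q
    rw [hneg]
end

section
/- Let X, Y, Z be real Banach spaces such that X =_BJ Y. Then X ⊕_∞ Z =_BJ Y ⊕_∞ Z. -/
open Filter Topology

section Descent

variable {X : Type*} [NormedAddCommGroup X] [NormedSpace ℝ X]

/-- `y` is a descent direction of the norm at `x`. -/
def NormDescent (x y : X) : Prop := ∃ l : ℝ, 0 < l ∧ ‖x + l • y‖ < ‖x‖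

lemma bjOrth_iff_not_normDescent (x y : X) :
    BJOrth x y ↔ ¬ NormDescent x y ∧ ¬ NormDescent x (-y) := by
  constructor
  · intro h
    refine ⟨fun ⟨l, _, hl⟩ => absurd (h l) hl.not_ge, fun ⟨l, _, hl⟩ => ?_⟩
    have := h (-l)
    rw [neg_smul, ← smul_neg] at this
    exact absurd this hl.not_ge
  · rintro ⟨h₁, h₂⟩ l
    by_contra! hl
    rcases lt_trichotomy l 0 with h | rfl | h
    · exact h₂ ⟨-l, neg_pos.2 h, by rwa [neg_smul_neg]⟩
    · simp at hl
    · exact h₁ ⟨l, h, hl⟩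

lemma NormDescent.not_neg {x y : X} (h : NormDescent x y) : ¬ NormDescent x (-y) := by
  rintro ⟨m, hm, hm'⟩
  obtain ⟨l, hl, hl'⟩ := h
  have key : (l + m) • x = m • (x + l • y) + l • (x + m • -y) := by module
  have h1 : (l + m) * ‖x‖ ≤ m * ‖x + l • y‖ + l * ‖x + m • -y‖ := by
    calc (l + m) * ‖x‖ = ‖(l + m) • x‖ := by
          rw [norm_smul, Real.norm_of_nonneg (by positivity)]
      _ ≤ _ := by
          rw [key]
          refine (norm_add_le _ _).trans_eq ?_
          rw [norm_smul, norm_smul, Real.norm_of_nonneg hm.le, Real.norm_of_nonneg hl.le]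
  nlinarith [mul_lt_mul_of_pos_left hl' hm, mul_lt_mul_of_pos_left hm' hl]

lemma isOpen_setOf_normDescent (x : X) : IsOpen {y | NormDescent x y} := by
  have : {y | NormDescent x y} = ⋃ l : ℝ, ⋃ _ : 0 < l, {y : X | ‖x + l • y‖ < ‖x‖} := by
    ext y; simp [NormDescent]
  rw [this]
  exact isOpen_iUnion fun l => isOpen_iUnion fun _ =>
    isOpen_lt (by fun_prop) continuous_const

lemma starConvex_setOf_normDescent (x : X) : StarConvex ℝ (-x) {y | NormDescent x y} := by
  rintro y ⟨m, hm, hm'⟩ a b ha hb hab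
  have hd : 0 < b + m * a := by
    rcases hb.eq_or_lt with rfl | hb
    · have : a = 1 := by linarith
      simp [this, hm]
    · positivity
  refine ⟨m / (b + m * a), by positivity, ?_⟩
  have key : x + (m / (b + m * a)) • (a • -x + b • y) = (b / (b + m * a)) • (x + m • y) := by
    have h : b / (b + m * a) = 1 - m / (b + m * a) * a := by field_simp; ring
    have h' : b / (b + m * a) * m = m / (b + m * a) * b := by ring
    rw [smul_add (b / (b + m * a)), smul_smul, h', h]
    module
  rw [key, norm_smul, Real.norm_of_nonneg (by positivity)]
  have h1 : b / (b + m * a) ≤ 1 := (div_le_one hd).2 (by nlinarith)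
  exact (mul_le_of_le_one_left (norm_nonneg _) h1).trans_lt hm'

lemma normDescent_neg_self {x : X} (hx : x ≠ 0) : NormDescent x (-x) :=
  ⟨1, one_pos, by simpa using hx⟩

lemma isPreconnected_setOf_normDescent {x : X} (hx : x ≠ 0) :
    IsPreconnected {y | NormDescent x y} :=
  (StarConvex.isPathConnected (starConvex_setOf_normDescent x)
    (normDescent_neg_self hx)).isConnected.isPreconnected

lemma eventually_norm_add_smul_lt_iff {x : X} (y : X) {M : ℝ} (hM : ‖x‖ ≤ M) :
    (∀ᶠ l : ℝ in 𝓝[>] 0, ‖x + l • y‖ < M) ↔ ‖x‖ < M ∨ NormDescent x y := by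
  constructor
  · intro h
    rcases hM.lt_or_eq with h' | rfl
    · exact Or.inl h'
    · obtain ⟨l, hl, hl'⟩ := (h.and self_mem_nhdsWithin).exists
      exact Or.inr ⟨l, hl', hl⟩
  · rintro (h | ⟨m, hm, hm'⟩)
    · have hc : Continuous fun l : ℝ => ‖x + l • y‖ := by fun_prop
      exact (hc.continuousAt.eventually_lt continuousAt_const (by simpa using h)).filter_mono
        nhdsWithin_le_nhds
    · filter_upwards [Ioo_mem_nhdsGT hm] with l ⟨hl, hlm⟩
      refine lt_of_lt_of_le ?_ hM
      have key : m • (x + l • y) = (m - l) • x + l • (x + m • y) := by module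
      have h1 : m * ‖x + l • y‖ ≤ (m - l) * ‖x‖ + l * ‖x + m • y‖ := by
        calc m * ‖x + l • y‖ = ‖m • (x + l • y)‖ := by
              rw [norm_smul, Real.norm_of_nonneg hm.le]
          _ ≤ _ := by
              rw [key]
              refine (norm_add_le _ _).trans_eq ?_
              rw [norm_smul, norm_smul, Real.norm_of_nonneg hl.le,
                Real.norm_of_nonneg (sub_nonneg.2 hlm.le)]
      nlinarith [mul_lt_mul_of_pos_left hm' hl]

lemma normDescent_iff_eventually (x y : X) :
    NormDescent x y ↔ ∀ᶠ l : ℝ in 𝓝[>] 0, ‖x + l • y‖ < ‖x‖ := by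
  simp [eventually_norm_add_smul_lt_iff y le_rfl]

variable {Y : Type*} [NormedAddCommGroup Y] [NormedSpace ℝ Y]

lemma normDescent_prod_iff (p q : X × Y) :
    NormDescent p q ↔ (‖p.1‖ < ‖p‖ ∨ NormDescent p.1 q.1) ∧
      (‖p.2‖ < ‖p‖ ∨ NormDescent p.2 q.2) := by
  rw [normDescent_iff_eventually, ← eventually_norm_add_smul_lt_iff _ (norm_fst_le p),
    ← eventually_norm_add_smul_lt_iff _ (norm_snd_le p), ← eventually_and]
  refine eventually_congr (Eventually.of_forall fun l => ?_)
  rw [Prod.norm_def (p + l • q), max_lt_iff]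
  rfl

lemma normDescent_map_iff {T : X → Y} (hT : Continuous T)
    (hneg : ∀ x, T (-x) = -T x) (horth : ∀ x y, BJOrth x y ↔ BJOrth (T x) (T y))
    (hzero : ∀ x, T x = 0 → x = 0) (x y : X) :
    NormDescent (T x) (T y) ↔ NormDescent x y := by
  have forward : ∀ y, NormDescent x y → NormDescent (T x) (T y) := by
    intro y hy
    have hx : x ≠ 0 := by
      rintro rfl
      obtain ⟨l, _, hl⟩ := hy
      exact absurd (norm_nonneg _) (not_le.2 (by simpa only [norm_zero] using hl))
    have hsub : T '' {y | NormDescent x y} ⊆ {y | NormDescent (T x) y} := by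
      have himage := (isPreconnected_setOf_normDescent hx).image T hT.continuousOn
      refine himage.subset_left_of_subset_union (isOpen_setOf_normDescent (T x))
        ((isOpen_setOf_normDescent (T x)).preimage continuous_neg) ?_ ?_ ?_
      · exact Set.disjoint_left.2 fun z hz hz' => NormDescent.not_neg hz hz'
      · rintro _ ⟨z, hz, rfl⟩
        have : ¬ BJOrth (T x) (T z) := fun h =>
          ((bjOrth_iff_not_normDescent x z).1 ((horth x z).2 h)).1 hz
        rw [bjOrth_iff_not_normDescent] at this
        by_contra h
        exact this (not_or.1 h)
      · refine ⟨T (-x), ⟨-x, normDescent_neg_self hx, rfl⟩, ?_⟩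
        rw [hneg]
        exact normDescent_neg_self fun h => hx (hzero x h)
    exact hsub ⟨y, hy, rfl⟩
  refine ⟨fun h => ?_, forward y⟩
  by_contra hxy
  have : BJOrth x y := (bjOrth_iff_not_normDescent x y).2
    ⟨hxy, fun h' => h.not_neg (hneg y ▸ forward (-y) h')⟩
  exact ((bjOrth_iff_not_normDescent _ _).1 ((horth x y).1 this)).1 h

end Descent

/-- Strong Birkhoff–James isomorphism is stable under taking the `∞`-direct sum with a
common factor (products carry the max norm). -/
theorem bjStrongIso_prod_right
    {X Y Z : Type*} [NormedAddCommGroup X] [NormedSpace ℝ X] [CompleteSpace X]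
    [NormedAddCommGroup Y] [NormedSpace ℝ Y] [CompleteSpace Y]
    [NormedAddCommGroup Z] [NormedSpace ℝ Z] [CompleteSpace Z]
    (hXY : BJStrongIso X Y) :
    BJStrongIso (X × Z) (Y × Z) := by
  obtain ⟨T, hnorm, hsmul, horth⟩ := hXY
  have hneg : ∀ x, T (-x) = -T x := fun x => by simpa using hsmul (-1) x
  have hzero : ∀ x, T x = 0 → x = 0 := fun x hx => by
    rw [← norm_eq_zero, ← hnorm, hx, norm_zero]
  have hdesc := normDescent_map_iff T.continuous hneg horth hzero
  have hnorm' : ∀ p : X × Z, ‖(T p.1, p.2)‖ = ‖p‖ := fun p => by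
    simp [Prod.norm_def, hnorm]
  have hdesc' : ∀ p q : X × Z, NormDescent (T p.1, p.2) (T q.1, q.2) ↔ NormDescent p q :=
    fun p q => by rw [normDescent_prod_iff, normDescent_prod_iff p q, hnorm', hnorm, hdesc]
  refine ⟨T.prodCongr (Homeomorph.refl Z), hnorm', fun c p => Prod.ext (hsmul c p.1) rfl,
    fun p q => ?_⟩
  rw [bjOrth_iff_not_normDescent, bjOrth_iff_not_normDescent, ← hdesc' p q, ← hdesc' p (-q)]
  change _ ∧ ¬ NormDescent (T p.1, p.2) (T (-q.1), -q.2) ↔ _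
  rw [hneg]
  rfl
end

section
/- Let X be a smooth Radon plane, i.e., a two-dimensional real Banach space that is smooth and in which Birkhoff–James orthogonality is symmetric. Then X =_BJ ℓ₂², i.e., there exists a norm-preserving homogeneous homeomorphism T from the two-dimensional Euclidean space ℓ₂² onto X such that x ⊥_BJ y in ℓ₂² if and only if T(x) ⊥_BJ T(y) in X. -/
open Filter Topology

section Orthogonality

variable {X : Type*} [NormedAddCommGroup X] [NormedSpace ℝ X]

theorem BJOrth.smul {x y : X} (h : BJOrth x y) (a b : ℝ) : BJOrth (a • x) (b • y) := by
  intro l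
  rcases eq_or_ne a 0 with rfl | ha
  · simp
  have key : a • x + l • b • y = a • (x + (a⁻¹ * l * b) • y) := by
    rw [smul_add, smul_smul, smul_smul]
    congr 2
    field_simp
  rw [key, norm_smul, norm_smul]
  exact mul_le_mul_of_nonneg_left (h _) (norm_nonneg a)

theorem BJOrth.zero_left (y : X) : BJOrth 0 y := fun l => by simp

theorem BJOrth.eq_zero_of_smul {x : X} {c : ℝ} (h : BJOrth x (c • x)) : c • x = 0 := by
  by_contra hne
  have hc : c ≠ 0 := fun hc => hne (by simp [hc])
  have hx : x ≠ 0 := fun hx => hne (by simp [hx])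
  have := h (-c⁻¹)
  rw [smul_smul, neg_mul, inv_mul_cancel₀ hc, neg_one_smul, add_neg_cancel, norm_zero] at this
  exact hx (norm_le_zero_iff.mp this)

theorem isClosed_setOf_bjOrth : IsClosed {p : X × X | BJOrth p.1 p.2} := by
  simp only [BJOrth, Set.ofPred_forall]
  exact isClosed_iInter fun l => isClosed_le (by fun_prop) (by fun_prop)

/-- Characterisation of orthogonality by supporting functionals, in a smooth space. -/
theorem SmoothSpace.exists_bjOrth_iff (hX : SmoothSpace X) {x : X} (hx : x ≠ 0) :
    ∃ f : X →L[ℝ] ℝ, f x = ‖x‖ ∧ ∀ y, BJOrth x y ↔ f y = 0 := by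
  obtain ⟨f, hf⟩ := hX x hx
  obtain ⟨hf1, hfx⟩ : ‖f‖ ≤ 1 ∧ f x = ‖x‖ := by
    have : f ∈ ({f} : Set (X →L[ℝ] ℝ)) := rfl
    rwa [← hf] at this
  refine ⟨f, hfx, fun y => ⟨fun hxy => ?_, fun hy l => ?_⟩⟩
  · let S : Submodule ℝ X := ℝ ∙ y
    obtain ⟨g, hg1, hgx⟩ := exists_dual_vector'' ℝ (S.mkQ x)
    have hmk (z : X) : ‖S.mkQ z‖ ≤ ‖z‖ := Submodule.Quotient.norm_mk_le S z
    have hxle : ‖x‖ ≤ ‖S.mkQ x‖ := by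
      refine le_of_forall_pos_lt_add fun ε hε => ?_
      obtain ⟨m, hm, hlt⟩ := Submodule.Quotient.norm_mk_lt (S := S) (S.mkQ x) hε
      obtain ⟨l, hl⟩ := Submodule.mem_span_singleton.mp ((Submodule.Quotient.eq S).mp hm)
      have : m = x + l • y := by rw [hl]; abel
      exact (this ▸ hxy l).trans_lt hlt
    let h : X →L[ℝ] ℝ := (g.toLinearMap ∘ₗ S.mkQ).mkContinuous 1 fun z => by
      rw [one_mul]
      exact ((g.le_of_opNorm_le hg1 _).trans_eq (one_mul _)).trans (hmk z)
    have hh : h ∈ ({f} : Set (X →L[ℝ] ℝ)) := by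
      rw [← hf]
      exact ⟨LinearMap.mkContinuous_norm_le _ zero_le_one _,
        hgx.trans (le_antisymm (hmk x) hxle)⟩
    have hy0 : S.mkQ y = 0 := by
      simp [S, Submodule.mem_span_singleton_self]
    rw [← Set.mem_singleton_iff.mp hh]
    change g (S.mkQ y) = 0
    rw [hy0, map_zero]
  · calc ‖x‖ = f (x + l • y) := by simp [hfx, hy]
      _ ≤ ‖f (x + l • y)‖ := le_abs_self _
      _ ≤ 1 * ‖x + l • y‖ := f.le_of_opNorm_le hf1 _
      _ = ‖x + l • y‖ := one_mul _

end Orthogonality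

/-- A norm-preserving map into a proper space is continuous if it is cut out by a closed relation. -/
theorem continuous_of_norm_eq_of_isClosed {V W : Type*} [NormedAddCommGroup V]
    [NormedAddCommGroup W] [ProperSpace W] {f : V → W} {r : Set (V × W)} (hr : IsClosed r)
    (hf : ∀ x, ‖f x‖ = ‖x‖) (hmem : ∀ x, (x, f x) ∈ r)
    (huniq : ∀ x y, ‖y‖ = ‖x‖ → (x, y) ∈ r → y = f x) : Continuous f := by
  refine continuous_iff_continuousAt.mpr fun x => ?_
  have hball : ∀ᶠ z in 𝓝 x, f z ∈ Metric.closedBall (0 : W) (‖x‖ + 1) := by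
    filter_upwards [continuous_norm.continuousAt.eventually_lt continuousAt_const
      (lt_add_one ‖x‖)] with z hz
    simpa [hf] using hz.le
  refine (isCompact_closedBall _ _).tendsto_nhds_of_unique_mapClusterPt hball fun y _ hy => ?_
  let r' : Set (V × W) := r ∩ {p | ‖p.2‖ = ‖p.1‖}
  have hr' : IsClosed r' := hr.inter (isClosed_eq (by fun_prop) (by fun_prop))
  have hclus : MapClusterPt (x, y) (𝓝 x) fun z => (z, f z) := by
    refine mapClusterPt_iff_frequently.mpr fun s hs => ?_
    obtain ⟨a, ha, b, hb, hab⟩ := mem_nhds_prod_iff.mp hs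
    exact ((hy.frequently hb).and_eventually ha).mono fun z hz => hab ⟨hz.2, hz.1⟩
  have hin : (x, y) ∈ r' :=
    hr'.mem_of_mapClusterPt hclus (Eventually.of_forall fun z => ⟨hmem z, hf z⟩)
  exact huniq x y hin.2 hin.1

/-- Two mutually orthogonal unit vectors `u`, `v` of a plane, with their dual coordinates. -/
structure BJFrame (X : Type*) [NormedAddCommGroup X] [NormedSpace ℝ X] where
  /-- The first unit vector. -/
  u : X
  /-- The second unit vector. -/
  v : X
  /-- The coordinate along `u`. -/
  φ : X →L[ℝ] ℝ
  /-- The coordinate along `v`. -/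
  ψ : X →L[ℝ] ℝ
  φ_u : φ u = 1
  φ_v : φ v = 0
  ψ_u : ψ u = 0
  ψ_v : ψ v = 1
  eq_add : ∀ z, z = φ z • u + ψ z • v
  norm_u : ‖u‖ = 1
  norm_v : ‖v‖ = 1
  bjOrth : BJOrth u v
  bjOrth_symm : BJOrth v u

section Plane

variable {X : Type*} [NormedAddCommGroup X] [NormedSpace ℝ X]

theorem nonempty_bjFrame (hdim : Module.finrank ℝ X = 2) (hX : SmoothSpace X)
    (hsymm : ∀ x y : X, BJOrth x y → BJOrth y x) : Nonempty (BJFrame X) := by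
  have : FiniteDimensional ℝ X := Module.finite_of_finrank_pos (by lia)
  have : Nontrivial X := Module.nontrivial_of_finrank_pos (R := ℝ) (by lia)
  obtain ⟨u, hu⟩ := exists_norm_eq X zero_le_one
  have hu0 : u ≠ 0 := norm_ne_zero_iff.mp (by simp [hu])
  obtain ⟨f, hfu, hf⟩ := hX.exists_bjOrth_iff hu0
  obtain ⟨w, hw, hw0⟩ : ∃ w ∈ f.toLinearMap.ker, w ≠ 0 := by
    refine Submodule.exists_mem_ne_zero_of_ne_bot fun hbot => ?_
    have := LinearMap.finrank_le_finrank_of_injective (LinearMap.ker_eq_bot.mp hbot)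
    rw [hdim, Module.finrank_self] at this
    lia
  have hnw : ‖w‖ ≠ 0 := norm_ne_zero_iff.mpr hw0
  let v := ‖w‖⁻¹ • w
  have hv : ‖v‖ = 1 := by simp [v, norm_smul, hnw]
  have hv0 : v ≠ 0 := norm_ne_zero_iff.mp (by simp [hv])
  have hfv : f v = 0 := by
    have : f w = 0 := hw
    simp [v, this]
  have huv : BJOrth u v := (hf v).mpr hfv
  obtain ⟨g, hgv, hg⟩ := hX.exists_bjOrth_iff hv0
  have hgu : g u = 0 := (hg u).mp (hsymm u v huv)
  rw [hu] at hfu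
  rw [hv] at hgv
  have hli : LinearIndependent ℝ ![u, v] := by
    refine LinearIndependent.pair_iff.mpr fun s t h => ⟨?_, ?_⟩
    · simpa [hfu, hfv] using congrArg f h
    · simpa [hgu, hgv] using congrArg g h
  have hspan : Submodule.span ℝ {u, v} = ⊤ := by
    have := hli.span_eq_top_of_card_eq_finrank' (by simp [hdim])
    simpa [Matrix.range_cons, Matrix.range_empty, Set.pair_comm] using this
  refine ⟨⟨u, v, f, g, hfu, hfv, hgu, hgv, fun z => ?_, hu, hv, huv, hsymm u v huv⟩⟩
  obtain ⟨a, b, rfl⟩ := Submodule.mem_span_pair.mp (hspan ▸ Submodule.mem_top : z ∈ _)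
  simp [hfu, hfv, hgu, hgv]

namespace BJFrame

variable (F : BJFrame X)

/-- The area form with `F.area F.u F.v = 1`. -/
def area (x y : X) : ℝ := F.φ x * F.ψ y - F.ψ x * F.φ y

theorem ext_coord {x y : X} (h₁ : F.φ x = F.φ y) (h₂ : F.ψ x = F.ψ y) : x = y := by
  rw [F.eq_add x, F.eq_add y, h₁, h₂]

theorem u_ne_zero : F.u ≠ 0 := norm_ne_zero_iff.mp (by simp [F.norm_u])

theorem v_ne_zero : F.v ≠ 0 := norm_ne_zero_iff.mp (by simp [F.norm_v])

theorem abs_φ_le (z : X) : |F.φ z| ≤ ‖z‖ := by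
  have h := F.bjOrth.smul (F.φ z) 1 (F.ψ z)
  rwa [one_smul, ← F.eq_add, norm_smul, F.norm_u, mul_one] at h

theorem abs_ψ_le (z : X) : |F.ψ z| ≤ ‖z‖ := by
  have h := F.bjOrth_symm.smul (F.ψ z) 1 (F.φ z)
  rwa [one_smul, add_comm, ← F.eq_add, norm_smul, F.norm_v, mul_one] at h

theorem eq_smul_of_area_eq_zero {x y : X} (hx : x ≠ 0) (h : F.area x y = 0) :
    ∃ c : ℝ, y = c • x := by
  unfold area at h
  by_cases h₁ : F.φ x = 0
  · have h₂ : F.ψ x ≠ 0 := fun h₂ => hx (by rw [F.eq_add x, h₁, h₂]; simp)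
    refine ⟨F.ψ y / F.ψ x, F.ext_coord ?_ ?_⟩
    · have : F.φ y = 0 := by simpa [h₁, h₂] using h
      simp [h₁, this]
    · simp [h₂]
  · refine ⟨F.φ y / F.φ x, F.ext_coord ?_ ?_⟩
    · simp [h₁]
    · simp only [map_smul, smul_eq_mul]
      field_simp
      linarith

theorem area_smul_eq (x y z : X) :
    F.area x y • z = F.area z y • x + F.area x z • y := by
  apply F.ext_coord <;> simp only [map_smul, map_add, smul_eq_mul, area] <;> ring

theorem eq_smul_of_bjOrth (F : BJFrame X) (hX : SmoothSpace X) {x y z : X} (hx : x ≠ 0) (hy : y ≠ 0)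
    (hxy : BJOrth x y) (hxz : BJOrth x z) : ∃ c : ℝ, z = c • y := by
  obtain ⟨f, hfx, hf⟩ := hX.exists_bjOrth_iff hx
  have h := congrArg f (F.area_smul_eq x y z)
  simp only [map_smul, map_add, smul_eq_mul, (hf y).mp hxy, (hf z).mp hxz, hfx, mul_zero,
    add_zero] at h
  refine F.eq_smul_of_area_eq_zero hy ?_
  have : F.area z y = 0 := by simpa [hx] using h
  unfold area at *
  linarith

/-- Orthogonal vectors lie in adjacent quadrants of the frame. -/
theorem coord_mul_neg_of_bjOrth (hX : SmoothSpace X)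
    (hsymm : ∀ x y : X, BJOrth x y → BJOrth y x) {x y : X} (hy : y ≠ 0)
    (hφ : F.φ x ≠ 0) (hψ : F.ψ x ≠ 0) (hxy : BJOrth x y) :
    F.φ x * F.ψ x * (F.φ y * F.ψ y) < 0 := by
  have hγ : F.φ y ≠ 0 := by
    intro h
    have hyv : y = F.ψ y • F.v := by simpa [h] using F.eq_add y
    have hψy : F.ψ y ≠ 0 := fun h' => hy (by rw [hyv, h', zero_smul])
    have hvx : BJOrth F.v x := by
      have := (hsymm _ _ hxy).smul (F.ψ y)⁻¹ 1
      rw [hyv] at this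
      simpa [smul_smul, hψy, F.ψ_v] using this
    obtain ⟨c, rfl⟩ := F.eq_smul_of_bjOrth hX F.v_ne_zero F.u_ne_zero F.bjOrth_symm hvx
    simp [F.ψ_u] at hψ
  have hδ : F.ψ y ≠ 0 := by
    intro h
    have hyu : y = F.φ y • F.u := by simpa [h] using F.eq_add y
    have hux : BJOrth F.u x := by
      have := (hsymm _ _ hxy).smul (F.φ y)⁻¹ 1
      rw [hyu] at this
      simpa [smul_smul, hγ, F.φ_u] using this
    obtain ⟨c, rfl⟩ := F.eq_smul_of_bjOrth hX F.u_ne_zero F.v_ne_zero F.bjOrth hux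
    simp [F.φ_v] at hφ
  by_contra! hnn
  have hpos : 0 < F.φ x * F.ψ x * (F.φ y * F.ψ y) := lt_of_le_of_ne hnn (by positivity)
  have h₁ : |F.φ x| ≤ |F.φ x - F.ψ x / F.ψ y * F.φ y| := by
    refine ((F.abs_φ_le x).trans (hxy (-(F.ψ x / F.ψ y)))).trans_eq ?_
    rw [F.eq_add (x + _)]
    simp [hδ, norm_smul, F.norm_u, sub_eq_add_neg]
  have h₂ : |F.ψ x| ≤ |F.ψ x - F.φ x / F.φ y * F.ψ y| := by
    refine ((F.abs_ψ_le x).trans (hxy (-(F.φ x / F.φ y)))).trans_eq ?_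
    rw [F.eq_add (x + _)]
    simp [hγ, norm_smul, F.norm_v, sub_eq_add_neg]
  generalize F.φ x = a at *
  generalize F.ψ x = b at *
  generalize F.φ y = c at *
  generalize F.ψ y = d at *
  have e₁ : a - b / d * c = (a * d - b * c) / d := by field_simp
  have e₂ : b - a / c * d = (b * c - a * d) / c := by field_simp
  rw [e₁, abs_div, le_div_iff₀ (abs_pos.mpr hδ), ← abs_mul, ← sq_le_sq] at h₁
  rw [e₂, abs_div, le_div_iff₀ (abs_pos.mpr hγ), ← abs_mul, ← sq_le_sq] at h₂
  nlinarith [mul_self_pos.mpr hφ, mul_self_pos.mpr hγ]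

/-- `y` is the positively oriented vector orthogonal to `x` and of the same norm. -/
structure IsTurn (x y : X) : Prop where
  norm_eq : ‖y‖ = ‖x‖
  orth : BJOrth x y
  area_nonneg : 0 ≤ F.area x y

variable {F}

theorem IsTurn.unique (hX : SmoothSpace X) {x y z : X} (hy : F.IsTurn x y)
    (hz : F.IsTurn x z) : y = z := by
  rcases eq_or_ne x 0 with rfl | hx
  · have h₁ := hy.norm_eq
    have h₂ := hz.norm_eq
    simp only [norm_zero, norm_eq_zero] at h₁ h₂
    rw [h₁, h₂]
  have hy0 : y ≠ 0 := norm_ne_zero_iff.mp (hy.norm_eq ▸ norm_ne_zero_iff.mpr hx)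
  obtain ⟨c, rfl⟩ := F.eq_smul_of_bjOrth hX hx hy0 hy.orth hz.orth
  have hc : |c| = 1 := by
    have := hz.norm_eq.trans hy.norm_eq.symm
    rw [norm_smul] at this
    exact mul_right_cancel₀ (norm_ne_zero_iff.mpr hy0) (this.trans (one_mul _).symm)
  rcases eq_or_eq_neg_of_abs_eq hc with rfl | rfl
  · simp
  · have h₁ := hy.area_nonneg
    have h₂ := hz.area_nonneg
    have h₀ : F.area x y = 0 := by
      simp only [area, map_smul, smul_eq_mul] at *
      linarith
    obtain ⟨d, rfl⟩ := F.eq_smul_of_area_eq_zero hx h₀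
    exact absurd hy.orth.eq_zero_of_smul hy0

theorem IsTurn.smul {x y : X} (h : F.IsTurn x y) (c : ℝ) : F.IsTurn (c • x) (c • y) where
  norm_eq := by rw [norm_smul, norm_smul, h.norm_eq]
  orth := h.orth.smul c c
  area_nonneg := by
    have := mul_nonneg (sq_nonneg c) h.area_nonneg
    simp only [area, map_smul, smul_eq_mul] at *
    linarith

theorem IsTurn.neg_symm (hsymm : ∀ x y : X, BJOrth x y → BJOrth y x) {x y : X}
    (h : F.IsTurn x y) : F.IsTurn y (-x) where
  norm_eq := by rw [norm_neg, h.norm_eq]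
  orth := by simpa using (hsymm _ _ h.orth).smul 1 (-1)
  area_nonneg := by
    have := h.area_nonneg
    simp only [area, map_neg] at *
    linarith

variable (F)

theorem isTurn_u_v : F.IsTurn F.u F.v :=
  ⟨F.norm_v.trans F.norm_u.symm, F.bjOrth, by simp [area, F.φ_u, F.ψ_u, F.ψ_v]⟩

theorem isClosed_setOf_isTurn : IsClosed {p : X × X | F.IsTurn p.1 p.2} := by
  have : {p : X × X | F.IsTurn p.1 p.2} =
      {p | ‖p.2‖ = ‖p.1‖} ∩ ({p | BJOrth p.1 p.2} ∩ {p | 0 ≤ F.area p.1 p.2}) :=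
    Set.ext fun p => ⟨fun h => ⟨h.1, h.2, h.3⟩, fun h => ⟨h.1, h.2.1, h.2.2⟩⟩
  rw [this]
  unfold area
  exact (isClosed_eq (by fun_prop) (by fun_prop)).inter
    (isClosed_setOf_bjOrth.inter (isClosed_le (by fun_prop) (by fun_prop)))

theorem exists_isTurn (hX : SmoothSpace X) (x : X) : ∃ y, F.IsTurn x y := by
  rcases eq_or_ne x 0 with rfl | hx
  · exact ⟨0, rfl, BJOrth.zero_left 0, by simp [area]⟩
  obtain ⟨f, hfx, hf⟩ := hX.exists_bjOrth_iff hx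
  let w := f F.v • F.u - f F.u • F.v
  have hw : BJOrth x w := (hf w).mpr (by simp [w]; ring)
  have hw0 : w ≠ 0 := by
    intro h
    have h₁ : f F.v = 0 := by simpa [w, F.φ_u, F.φ_v] using congrArg F.φ h
    have h₂ : f F.u = 0 := by simpa [w, F.ψ_u, F.ψ_v] using congrArg F.ψ h
    have : f x = 0 := by rw [F.eq_add x]; simp [h₁, h₂]
    exact hx (norm_eq_zero.mp (hfx.symm.trans this))
  have hscale (s : ℝ) (hs : |s| = 1) : ‖(s * (‖x‖ / ‖w‖)) • w‖ = ‖x‖ := by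
    rw [norm_smul, Real.norm_eq_abs, abs_mul, hs, one_mul, abs_of_nonneg (by positivity)]
    field_simp
  have horth (s : ℝ) : BJOrth x (s • w) := by simpa using hw.smul 1 s
  have harea (s : ℝ) : F.area x (s • w) = s * F.area x w := by
    simp only [area, map_smul, smul_eq_mul]; ring
  rcases le_total 0 (F.area x w) with h | h
  · exact ⟨_, hscale 1 (by simp), horth _, by rw [harea, one_mul]; positivity⟩
  · refine ⟨_, hscale (-1) (by simp), horth _, ?_⟩
    rw [harea, neg_one_mul, neg_mul]
    exact neg_nonneg.mpr (mul_nonpos_of_nonneg_of_nonpos (by positivity) h)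

/-- The quarter turn of the plane with respect to Birkhoff–James orthogonality. -/
noncomputable def turn (hX : SmoothSpace X) (x : X) : X :=
  (F.exists_isTurn hX x).choose

theorem isTurn_turn (hX : SmoothSpace X) (x : X) : F.IsTurn x (F.turn hX x) :=
  (F.exists_isTurn hX x).choose_spec

theorem norm_turn (hX : SmoothSpace X) (x : X) : ‖F.turn hX x‖ = ‖x‖ :=
  (F.isTurn_turn hX x).norm_eq

theorem turn_smul (hX : SmoothSpace X) (c : ℝ) (x : X) :
    F.turn hX (c • x) = c • F.turn hX x :=
  (F.isTurn_turn hX _).unique hX ((F.isTurn_turn hX x).smul c)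

theorem turn_neg (hX : SmoothSpace X) (x : X) : F.turn hX (-x) = -F.turn hX x := by
  simpa using F.turn_smul hX (-1) x

theorem turn_turn (hX : SmoothSpace X) (hsymm : ∀ x y : X, BJOrth x y → BJOrth y x) (x : X) :
    F.turn hX (F.turn hX x) = -x :=
  (F.isTurn_turn hX _).unique hX ((F.isTurn_turn hX x).neg_symm hsymm)

theorem turn_u (hX : SmoothSpace X) : F.turn hX F.u = F.v :=
  (F.isTurn_turn hX _).unique hX F.isTurn_u_v

theorem turn_v (hX : SmoothSpace X) (hsymm : ∀ x y : X, BJOrth x y → BJOrth y x) :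
    F.turn hX F.v = -F.u := by
  rw [← F.turn_u hX, F.turn_turn hX hsymm]

theorem continuous_turn [ProperSpace X] (hX : SmoothSpace X) : Continuous (F.turn hX) :=
  continuous_of_norm_eq_of_isClosed F.isClosed_setOf_isTurn (F.norm_turn hX)
    (F.isTurn_turn hX) fun x _ _ h => h.unique hX (F.isTurn_turn hX x)

theorem bjOrth_iff_exists_turn (hX : SmoothSpace X) {x y : X} (hx : x ≠ 0) :
    BJOrth x y ↔ ∃ c : ℝ, y = c • F.turn hX x := by
  have hturn := F.isTurn_turn hX x
  constructor
  · refine F.eq_smul_of_bjOrth hX hx (fun h => hx ?_) hturn.orth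
    rw [← norm_eq_zero, ← F.norm_turn hX, h, norm_zero]
  · rintro ⟨c, rfl⟩
    simpa using hturn.orth.smul 1 c

theorem turn_coord_mul_neg (hX : SmoothSpace X) (hsymm : ∀ x y : X, BJOrth x y → BJOrth y x)
    {x : X} (hx : F.φ x * F.ψ x ≠ 0) :
    F.φ x * F.ψ x * (F.φ (F.turn hX x) * F.ψ (F.turn hX x)) < 0 := by
  refine F.coord_mul_neg_of_bjOrth hX hsymm ?_ (left_ne_zero_of_mul hx)
    (right_ne_zero_of_mul hx) (F.isTurn_turn hX x).orth
  rw [← norm_ne_zero_iff, F.norm_turn, norm_ne_zero_iff]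
  rintro rfl
  simp at hx

end BJFrame

end Plane

section Euclidean

/-- The plane with the Euclidean norm. -/
abbrev EuclideanPlane : Type := EuclideanSpace ℝ (Fin 2)

/-- The Euclidean quarter turn. -/
def euclideanTurn (p : EuclideanPlane) : EuclideanPlane := !₂[-p 1, p 0]

@[simp] theorem euclideanTurn_zero (p : EuclideanPlane) : euclideanTurn p 0 = -p 1 := rfl

@[simp] theorem euclideanTurn_one (p : EuclideanPlane) : euclideanTurn p 1 = p 0 := rfl

theorem EuclideanSpace.ext_fin_two {p q : EuclideanPlane} (h₀ : p 0 = q 0) (h₁ : p 1 = q 1) : p = q := by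
  ext i
  fin_cases i <;> assumption

theorem EuclideanSpace.sq_norm_fin_two (p : EuclideanPlane) : ‖p‖ ^ 2 = p 0 ^ 2 + p 1 ^ 2 := by
  simp [EuclideanSpace.norm_sq_eq]

theorem norm_euclideanTurn (p : EuclideanPlane) : ‖euclideanTurn p‖ = ‖p‖ := by
  rw [← sq_eq_sq₀ (norm_nonneg _) (norm_nonneg _)]
  simp only [EuclideanSpace.sq_norm_fin_two, euclideanTurn_zero, euclideanTurn_one]
  ring

theorem continuous_euclideanTurn : Continuous euclideanTurn := by
  unfold euclideanTurn
  fun_prop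

theorem euclideanTurn_smul (c : ℝ) (p : EuclideanPlane) : euclideanTurn (c • p) = c • euclideanTurn p :=
  EuclideanSpace.ext_fin_two (by simp) (by simp)

theorem euclideanTurn_euclideanTurn (p : EuclideanPlane) : euclideanTurn (euclideanTurn p) = -p :=
  EuclideanSpace.ext_fin_two (by simp) (by simp)

theorem euclideanTurn_injective : Function.Injective euclideanTurn := fun p q h => by
  rw [← neg_inj, ← euclideanTurn_euclideanTurn, h, euclideanTurn_euclideanTurn]

theorem EuclideanSpace.bjOrth_iff_exists_turn {p q : EuclideanPlane} (hp : p ≠ 0) :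
    BJOrth p q ↔ ∃ c : ℝ, q = c • euclideanTurn p := by
  have hpos : 0 < p 0 ^ 2 + p 1 ^ 2 := by
    rw [← EuclideanSpace.sq_norm_fin_two]
    positivity
  constructor
  · intro h
    have hinner : p 0 * q 0 + p 1 * q 1 = 0 := by
      set a := p 0 * q 0 + p 1 * q 1 with ha
      set b := q 0 ^ 2 + q 1 ^ 2 with hb
      have hb0 : 0 ≤ b := by positivity
      have key := pow_le_pow_left₀ (norm_nonneg _) (h (-a / (b + 1))) 2
      simp only [EuclideanSpace.sq_norm_fin_two, PiLp.add_apply, PiLp.smul_apply,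
        smul_eq_mul] at key
      have key' : 0 ≤ 2 * (-a / (b + 1)) * a + (-a / (b + 1)) ^ 2 * b := by
        rw [ha, hb] at *
        linarith
      have heq : 2 * (-a / (b + 1)) * a + (-a / (b + 1)) ^ 2 * b
          = -(a ^ 2 * (b + 2) / (b + 1) ^ 2) := by
        field_simp
        ring
      rw [heq] at key'
      by_contra hne
      have : 0 < a ^ 2 * (b + 2) / (b + 1) ^ 2 := by positivity
      linarith
    refine ⟨(p 0 * q 1 - p 1 * q 0) / (p 0 ^ 2 + p 1 ^ 2),
      EuclideanSpace.ext_fin_two ?_ ?_⟩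
    · simp only [PiLp.smul_apply, euclideanTurn_zero, smul_eq_mul]
      field_simp
      linear_combination p 0 * hinner
    · simp only [PiLp.smul_apply, euclideanTurn_one, smul_eq_mul]
      field_simp
      linear_combination p 1 * hinner
  · rintro ⟨c, rfl⟩ l
    refine (sq_le_sq₀ (norm_nonneg _) (norm_nonneg _)).mp ?_
    simp only [EuclideanSpace.sq_norm_fin_two, PiLp.add_apply, PiLp.smul_apply,
      euclideanTurn_zero, euclideanTurn_one, smul_eq_mul]
    nlinarith [mul_nonneg (sq_nonneg (l * c)) hpos.le]

namespace BJFrame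

variable {X : Type*} [NormedAddCommGroup X] [NormedSpace ℝ X] (F : BJFrame X)

/-- The vector with the given coordinates. -/
def ofCoord (p : EuclideanPlane) : X := p 0 • F.u + p 1 • F.v

@[simp] theorem φ_ofCoord (p : EuclideanPlane) : F.φ (F.ofCoord p) = p 0 := by
  simp [ofCoord, F.φ_u, F.φ_v]

@[simp] theorem ψ_ofCoord (p : EuclideanPlane) : F.ψ (F.ofCoord p) = p 1 := by
  simp [ofCoord, F.ψ_u, F.ψ_v]

theorem ofCoord_smul (c : ℝ) (p : EuclideanPlane) : F.ofCoord (c • p) = c • F.ofCoord p := by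
  apply F.ext_coord <;> simp

theorem continuous_ofCoord : Continuous F.ofCoord := by
  unfold ofCoord
  fun_prop

theorem ofCoord_ne_zero {p : EuclideanPlane} (hp : p ≠ 0) : F.ofCoord p ≠ 0 := by
  refine fun h => hp (EuclideanSpace.ext_fin_two ?_ ?_)
  · simpa using congrArg F.φ h
  · simpa using congrArg F.ψ h

theorem norm_ofCoord {p : EuclideanPlane} (hp : p 0 * p 1 = 0) : ‖F.ofCoord p‖ = ‖p‖ := by
  rw [← sq_eq_sq₀ (norm_nonneg _) (norm_nonneg _), EuclideanSpace.sq_norm_fin_two]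
  rcases mul_eq_zero.mp hp with h | h <;> simp [ofCoord, h, norm_smul, F.norm_u, F.norm_v]

/-- The rescaling of `BJFrame.ofCoord` that preserves norms. -/
noncomputable def radial (p : EuclideanPlane) : X := (‖p‖ / ‖F.ofCoord p‖) • F.ofCoord p

theorem norm_radial (p : EuclideanPlane) : ‖F.radial p‖ = ‖p‖ := by
  rcases eq_or_ne p 0 with rfl | hp
  · simp [radial]
  · have := norm_ne_zero_iff.mpr (F.ofCoord_ne_zero hp)
    rw [radial, norm_smul, norm_div, norm_norm, norm_norm, div_mul_cancel₀ _ this]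

theorem radial_smul (c : ℝ) (p : EuclideanPlane) : F.radial (c • p) = c • F.radial p := by
  rcases eq_or_ne c 0 with rfl | hc
  · simp [radial]
  · have : ‖c‖ ≠ 0 := norm_ne_zero_iff.mpr hc
    rw [radial, radial, ofCoord_smul, norm_smul, norm_smul, mul_div_mul_left _ _ this,
      smul_comm]

theorem radial_neg (p : EuclideanPlane) : F.radial (-p) = -F.radial p := by
  simpa using F.radial_smul (-1) p

theorem continuous_radial [ProperSpace X] : Continuous F.radial := by
  have hcont := F.continuous_ofCoord
  refine continuous_of_norm_eq_of_isClosed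
    (r := {z : EuclideanPlane × X | ‖F.ofCoord z.1‖ • z.2 = ‖z.1‖ • F.ofCoord z.1})
    (isClosed_eq (by fun_prop) (by fun_prop)) F.norm_radial (fun p => ?_) fun p y hy h => ?_
  · rcases eq_or_ne p 0 with rfl | hp
    · simp [radial]
    · have := norm_ne_zero_iff.mpr (F.ofCoord_ne_zero hp)
      simp only [Set.mem_ofPred_eq, radial, smul_smul, mul_div_cancel₀ _ this]
  · rcases eq_or_ne p 0 with rfl | hp
    · rw [norm_zero, norm_eq_zero] at hy
      simp [radial, hy]
    · have := norm_ne_zero_iff.mpr (F.ofCoord_ne_zero hp)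
      rw [Set.mem_ofPred_eq] at h
      rw [radial, div_eq_inv_mul, mul_smul, ← h, inv_smul_smul₀ this]

theorem exists_radial_eq (x : X) :
    ∃ p : EuclideanPlane, F.radial p = x := by
  rcases eq_or_ne x 0 with rfl | hx
  · exact ⟨0, by simp [radial]⟩
  let q : EuclideanPlane := !₂[F.φ x, F.ψ x]
  have hq : F.ofCoord q = x := (F.eq_add x).symm
  have hq0 : ‖q‖ ≠ 0 := by
    refine norm_ne_zero_iff.mpr fun h => hx ?_
    rw [← hq, h]
    simp [ofCoord]
  have hx' : ‖x‖ ≠ 0 := norm_ne_zero_iff.mpr hx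
  refine ⟨(‖x‖ / ‖q‖) • q, ?_⟩
  rw [radial_smul, radial, hq, smul_smul]
  field_simp
  exact one_smul ℝ x

theorem radial_injective : Function.Injective F.radial := by
  intro p q h
  have hn : ‖p‖ = ‖q‖ := by rw [← F.norm_radial, h, F.norm_radial]
  rcases eq_or_ne p 0 with rfl | hp
  · rw [norm_zero] at hn
    exact (norm_eq_zero.mp hn.symm).symm
  have hq : q ≠ 0 := norm_ne_zero_iff.mp (hn ▸ norm_ne_zero_iff.mpr hp)
  have hp' := norm_ne_zero_iff.mpr hp
  have hP := norm_pos_iff.mpr (F.ofCoord_ne_zero hp)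
  have hQ := norm_pos_iff.mpr (F.ofCoord_ne_zero hq)
  let c := ‖F.ofCoord p‖ / ‖F.ofCoord q‖
  have hc : 0 < c := div_pos hP hQ
  have hpq : p = c • q := by
    have h₀ := congrArg F.φ h
    have h₁ := congrArg F.ψ h
    simp only [radial, ← hn, map_smul, φ_ofCoord, ψ_ofCoord, smul_eq_mul] at h₀ h₁
    field_simp at h₀ h₁
    refine EuclideanSpace.ext_fin_two ?_ ?_
    · simp only [c, PiLp.smul_apply, smul_eq_mul]
      field_simp
      linarith
    · simp only [c, PiLp.smul_apply, smul_eq_mul]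
      field_simp
      linarith
  have hc1 : c = 1 := by
    have := congrArg norm hpq
    rw [norm_smul, ← hn, Real.norm_of_nonneg hc.le] at this
    exact mul_right_cancel₀ hp' (this.symm.trans (one_mul _).symm)
  rw [hpq, hc1, one_smul]

theorem sign_radial (p : EuclideanPlane) :
    SignType.sign (F.φ (F.radial p) * F.ψ (F.radial p)) = SignType.sign (p 0 * p 1) := by
  rcases eq_or_ne p 0 with rfl | hp
  · simp [radial]
  have hpos : 0 < ‖p‖ / ‖F.ofCoord p‖ :=
    div_pos (norm_pos_iff.mpr hp) (norm_pos_iff.mpr (F.ofCoord_ne_zero hp))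
  simp only [radial, map_smul, φ_ofCoord, ψ_ofCoord, smul_eq_mul, sign_mul, sign_pos hpos,
    one_mul]

theorem radial_eq_neg_turn (hX : SmoothSpace X) (hsymm : ∀ x y : X, BJOrth x y → BJOrth y x)
    {p : EuclideanPlane} (hp : p 0 * p 1 = 0) :
    F.radial p = -F.turn hX (F.radial (euclideanTurn p)) := by
  have haxis {q : EuclideanPlane} (hq : q 0 * q 1 = 0) : F.radial q = F.ofCoord q := by
    rcases eq_or_ne q 0 with rfl | hq0
    · simp [radial, ofCoord]
    · rw [radial, F.norm_ofCoord hq, div_self (norm_ne_zero_iff.mpr hq0), one_smul]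
  rw [haxis hp, haxis (by simpa [mul_comm] using hp)]
  rcases mul_eq_zero.mp hp with h | h <;>
    simp [ofCoord, h, turn_smul, turn_neg, F.turn_u hX, F.turn_v hX hsymm]

/-- The radial rescaling on the first and third quadrants, continued to the other two quadrants
by quarter turns. -/
noncomputable def ofEuclidean (hX : SmoothSpace X) (p : EuclideanPlane) : X :=
  if 0 ≤ p 0 * p 1 then F.radial p else -F.turn hX (F.radial (euclideanTurn p))

variable {F} in
theorem ofEuclidean_of_nonneg (hX : SmoothSpace X) {p : EuclideanPlane} (hp : 0 ≤ p 0 * p 1) :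
    F.ofEuclidean hX p = F.radial p := if_pos hp

theorem ofEuclidean_of_nonpos (hX : SmoothSpace X)
    (hsymm : ∀ x y : X, BJOrth x y → BJOrth y x) {p : EuclideanPlane} (hp : p 0 * p 1 ≤ 0) :
    F.ofEuclidean hX p = -F.turn hX (F.radial (euclideanTurn p)) := by
  rcases hp.lt_or_eq with h | h
  · exact if_neg h.not_ge
  · rw [ofEuclidean_of_nonneg hX h.ge, F.radial_eq_neg_turn hX hsymm h]

theorem norm_ofEuclidean (hX : SmoothSpace X) (p : EuclideanPlane) : ‖F.ofEuclidean hX p‖ = ‖p‖ := by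
  unfold ofEuclidean
  split_ifs
  · exact F.norm_radial p
  · rw [norm_neg, norm_turn, norm_radial, norm_euclideanTurn]

theorem ofEuclidean_smul (hX : SmoothSpace X) (c : ℝ) (p : EuclideanPlane) :
    F.ofEuclidean hX (c • p) = c • F.ofEuclidean hX p := by
  rcases eq_or_ne c 0 with rfl | hc
  · simp [ofEuclidean, radial]
  have hiff : 0 ≤ (c • p) 0 * (c • p) 1 ↔ 0 ≤ p 0 * p 1 := by
    have hc2 : 0 < c * c := mul_self_pos.mpr hc
    rw [PiLp.smul_apply, PiLp.smul_apply, smul_eq_mul, smul_eq_mul, mul_mul_mul_comm,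
      mul_nonneg_iff_of_pos_left hc2]
  simp only [ofEuclidean, hiff, euclideanTurn_smul, radial_smul, turn_smul, smul_neg, smul_ite]

theorem continuous_ofEuclidean [ProperSpace X] (hX : SmoothSpace X)
    (hsymm : ∀ x y : X, BJOrth x y → BJOrth y x) : Continuous (F.ofEuclidean hX) := by
  refine Continuous.if_le F.continuous_radial
    ((F.continuous_turn hX).comp (F.continuous_radial.comp continuous_euclideanTurn)).neg
    continuous_const (by fun_prop) fun p hp => F.radial_eq_neg_turn hX hsymm hp.symm

theorem ofEuclidean_euclideanTurn (hX : SmoothSpace X)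
    (hsymm : ∀ x y : X, BJOrth x y → BJOrth y x) (p : EuclideanPlane) :
    F.ofEuclidean hX (euclideanTurn p) = F.turn hX (F.ofEuclidean hX p) := by
  rcases le_total 0 (p 0 * p 1) with h | h
  · rw [ofEuclidean_of_nonneg hX h, F.ofEuclidean_of_nonpos hX hsymm (by simpa [mul_comm] using h),
      euclideanTurn_euclideanTurn, radial_neg, turn_neg, neg_neg]
  · rw [F.ofEuclidean_of_nonpos hX hsymm h, turn_neg, F.turn_turn hX hsymm, neg_neg,
      ofEuclidean_of_nonneg hX (by simpa [mul_comm] using h)]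

theorem sign_turn (hX : SmoothSpace X) (hsymm : ∀ x y : X, BJOrth x y → BJOrth y x) {x : X}
    (hx : F.φ x * F.ψ x ≠ 0) :
    SignType.sign (F.φ (F.turn hX x) * F.ψ (F.turn hX x)) =
      -SignType.sign (F.φ x * F.ψ x) := by
  have h := F.turn_coord_mul_neg hX hsymm hx
  rcases hx.lt_or_gt with h' | h'
  · rw [sign_neg h', neg_neg, sign_pos (pos_of_mul_neg_right h h'.le)]
  · rw [sign_pos h', sign_neg (neg_of_mul_neg_right h h'.le)]

theorem sign_ofEuclidean (hX : SmoothSpace X) (hsymm : ∀ x y : X, BJOrth x y → BJOrth y x)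
    (p : EuclideanPlane) : SignType.sign (F.φ (F.ofEuclidean hX p) * F.ψ (F.ofEuclidean hX p)) =
      SignType.sign (p 0 * p 1) := by
  rcases le_or_gt 0 (p 0 * p 1) with h | h
  · rw [ofEuclidean_of_nonneg hX h, sign_radial]
  · have hsign : SignType.sign (F.φ (F.radial (euclideanTurn p)) *
        F.ψ (F.radial (euclideanTurn p))) = 1 := by
      rw [sign_radial]
      exact sign_pos (by simpa [mul_comm] using h)
    have hne : F.φ (F.radial (euclideanTurn p)) * F.ψ (F.radial (euclideanTurn p)) ≠ 0 :=
      fun h0 => by simp [h0] at hsign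
    rw [F.ofEuclidean_of_nonpos hX hsymm h.le, map_neg, map_neg, neg_mul_neg,
      F.sign_turn hX hsymm hne, hsign, sign_neg h]

theorem turn_injective (hX : SmoothSpace X) (hsymm : ∀ x y : X, BJOrth x y → BJOrth y x) :
    Function.Injective (F.turn hX) := fun x y h => by
  rw [← neg_inj, ← F.turn_turn hX hsymm, h, F.turn_turn hX hsymm]

theorem ofEuclidean_injective (hX : SmoothSpace X)
    (hsymm : ∀ x y : X, BJOrth x y → BJOrth y x) : Function.Injective (F.ofEuclidean hX) := by
  intro p q h
  have hs : SignType.sign (p 0 * p 1) = SignType.sign (q 0 * q 1) := by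
    rw [← F.sign_ofEuclidean hX hsymm, h, F.sign_ofEuclidean hX hsymm]
  rcases le_or_gt 0 (p 0 * p 1) with hp | hp
  · have hq : 0 ≤ q 0 * q 1 := by rwa [← sign_nonneg_iff, ← hs, sign_nonneg_iff]
    rw [ofEuclidean_of_nonneg hX hp, ofEuclidean_of_nonneg hX hq] at h
    exact F.radial_injective h
  · have hq : q 0 * q 1 < 0 := by rwa [← sign_eq_neg_one_iff, ← hs, sign_eq_neg_one_iff]
    rw [F.ofEuclidean_of_nonpos hX hsymm hp.le, F.ofEuclidean_of_nonpos hX hsymm hq.le,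
      neg_inj] at h
    exact euclideanTurn_injective (F.radial_injective (F.turn_injective hX hsymm h))

theorem ofEuclidean_surjective (hX : SmoothSpace X)
    (hsymm : ∀ x y : X, BJOrth x y → BJOrth y x) : Function.Surjective (F.ofEuclidean hX) := by
  intro x
  rcases le_or_gt 0 (F.φ x * F.ψ x) with hx | hx
  · obtain ⟨p, rfl⟩ := F.exists_radial_eq x
    refine ⟨p, ofEuclidean_of_nonneg hX ?_⟩
    rwa [← sign_nonneg_iff, ← F.sign_radial, sign_nonneg_iff]
  · obtain ⟨p, hp⟩ := F.exists_radial_eq (-F.turn hX x)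
    have hsign : SignType.sign (p 0 * p 1) = 1 := by
      rw [← F.sign_radial, hp, map_neg, map_neg, neg_mul_neg, F.sign_turn hX hsymm hx.ne,
        sign_neg hx, neg_neg]
    refine ⟨euclideanTurn p, ?_⟩
    rw [F.ofEuclidean_euclideanTurn hX hsymm,
      ofEuclidean_of_nonneg hX (sign_eq_one_iff.mp hsign).le, hp, turn_neg,
      F.turn_turn hX hsymm, neg_neg]

theorem bjOrth_ofEuclidean_iff (hX : SmoothSpace X)
    (hsymm : ∀ x y : X, BJOrth x y → BJOrth y x) (p q : EuclideanPlane) :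
    BJOrth p q ↔ BJOrth (F.ofEuclidean hX p) (F.ofEuclidean hX q) := by
  rcases eq_or_ne p 0 with rfl | hp
  · have : F.ofEuclidean hX 0 = 0 := by rw [← norm_eq_zero, norm_ofEuclidean, norm_zero]
    rw [this]
    exact iff_of_true (BJOrth.zero_left q) (BJOrth.zero_left _)
  have hTp : F.ofEuclidean hX p ≠ 0 := by
    rwa [← norm_ne_zero_iff, norm_ofEuclidean, norm_ne_zero_iff]
  rw [EuclideanSpace.bjOrth_iff_exists_turn hp, F.bjOrth_iff_exists_turn hX hTp]
  refine exists_congr fun c => ?_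
  rw [← F.ofEuclidean_euclideanTurn hX hsymm, ← ofEuclidean_smul,
    (F.ofEuclidean_injective hX hsymm).eq_iff]

theorem isHomeomorph_ofEuclidean [ProperSpace X] (hX : SmoothSpace X)
    (hsymm : ∀ x y : X, BJOrth x y → BJOrth y x) : IsHomeomorph (F.ofEuclidean hX) := by
  have hcont := F.continuous_ofEuclidean hX hsymm
  refine isHomeomorph_iff_continuous_isClosedMap_bijective.mpr ⟨hcont, ?_,
    F.ofEuclidean_injective hX hsymm, F.ofEuclidean_surjective hX hsymm⟩
  refine (isProperMap_iff_tendsto_cocompact.mpr ⟨hcont, ?_⟩).isClosedMap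
  rw [← Metric.cobounded_eq_cocompact, ← Metric.cobounded_eq_cocompact,
    ← tendsto_norm_atTop_iff_cobounded]
  simpa only [F.norm_ofEuclidean] using tendsto_norm_cobounded_atTop (E := EuclideanPlane)

end BJFrame

end Euclidean

/-- A smooth Radon plane is strongly isomorphic to the Euclidean plane with respect to
Birkhoff–James orthogonality: there is a norm-preserving homogeneous homeomorphism
`T : ℓ₂² → X` preserving Birkhoff–James orthogonality in both directions. -/
theorem smooth_radon_plane_bj_eq_euclidean
    {X : Type*} [NormedAddCommGroup X] [NormedSpace ℝ X] [CompleteSpace X]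
    (hdim : Module.finrank ℝ X = 2) (hsmooth : SmoothSpace X)
    (hradon : ∀ x y : X, BJOrth x y → BJOrth y x) :
    ∃ T : EuclideanSpace ℝ (Fin 2) ≃ₜ X,
      (∀ x : EuclideanSpace ℝ (Fin 2), ‖T x‖ = ‖x‖) ∧
      (∀ (c : ℝ) (x : EuclideanSpace ℝ (Fin 2)), T (c • x) = c • T x) ∧
      ∀ x y : EuclideanSpace ℝ (Fin 2), BJOrth x y ↔ BJOrth (T x) (T y) := by
  have : FiniteDimensional ℝ X := Module.finite_of_finrank_pos (by lia)
  have : ProperSpace X := FiniteDimensional.proper_real X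
  obtain ⟨F⟩ := nonempty_bjFrame hdim hsmooth hradon
  exact ⟨(F.isHomeomorph_ofEuclidean hsmooth hradon).homeomorph _,
    F.norm_ofEuclidean hsmooth, F.ofEuclidean_smul hsmooth,
    F.bjOrth_ofEuclidean_iff hsmooth hradon⟩
end

section
/- Let X be a real Banach space and I a nonempty set. If X does not contain a two-dimensional Hilbert subspace, then X ⊕_∞ c₀(I) does not contain a two-dimensional Hilbert subspace either. -/
open ZeroAtInfty

/-- A normed space `Z` contains a two-dimensional Hilbert subspace if there are vectors
`u, v` with `‖α • u + β • v‖ = √(α² + β²)` for all `α β : ℝ`. -/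
def ContainsHilbertPlane (Z : Type*) [NormedAddCommGroup Z] [Module ℝ Z] : Prop :=
  ∃ u v : Z, ∀ α β : ℝ, ‖α • u + β • v‖ = Real.sqrt (α ^ 2 + β ^ 2)

/-- On a nonempty discrete space, the norm of a function vanishing at infinity is attained. -/
lemma exists_norm_eq_norm_apply {I : Type*} [TopologicalSpace I] [Nonempty I]
    (c : C₀(I, ℝ)) : ∃ i, ‖c‖ = ‖c i‖ := by
  suffices h : ∃ i, ∀ j, ‖c j‖ ≤ ‖c i‖ by
    obtain ⟨i, hi⟩ := h
    refine ⟨i, le_antisymm ?_ ?_⟩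
    · rw [← ZeroAtInftyContinuousMap.norm_toBCF_eq_norm]
      exact (BoundedContinuousFunction.norm_le (norm_nonneg _)).2 hi
    · rw [← ZeroAtInftyContinuousMap.norm_toBCF_eq_norm]
      exact c.toBCF.norm_coe_le_norm i
  by_cases h0 : ∃ i, c i ≠ 0
  · obtain ⟨i, hi⟩ := h0
    have hc : Continuous fun j => ‖c j‖ := (map_continuous c).norm
    refine hc.exists_forall_ge' i ?_
    have ht := (zero_at_infty c).norm
    rw [norm_zero] at ht
    exact (ht.eventually (gt_mem_nhds (norm_pos_iff.2 hi))).mono fun _ h => h.le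
  · push Not at h0
    exact ⟨Classical.arbitrary I, fun j => by simp [h0]⟩

/-- A function vanishing at infinity on a discrete space is large only finitely often. -/
lemma finite_setOf_le_abs {I : Type*} [TopologicalSpace I] [DiscreteTopology I]
    (c : C₀(I, ℝ)) {ε : ℝ} (hε : 0 < ε) : {i | ε ≤ |c i|}.Finite := by
  have ht := (zero_at_infty c).norm
  rw [norm_zero, Filter.cocompact_eq_cofinite] at ht
  have h := ht.eventually (gt_mem_nhds hε)
  rw [Filter.eventually_cofinite] at h
  simpa using h

/-- Only finitely many points of a line avoiding the origin lie on finitely many given lines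
through the origin; here the former line passes through `(α, β)` and is orthogonal to it. -/
lemma finite_setOf_exists_parallel {I : Type*} {F : Set I} (hF : F.Finite) (a b : I → ℝ)
    (hab : ∀ i ∈ F, a i ^ 2 + b i ^ 2 ≠ 0) {α β : ℝ} (h : α ^ 2 + β ^ 2 ≠ 0) :
    {s : ℝ | ∃ i ∈ F, (α - s * β) * b i - (β + s * α) * a i = 0}.Finite := by
  have hU : {s : ℝ | ∃ i ∈ F, (α - s * β) * b i - (β + s * α) * a i = 0} =
      ⋃ i ∈ F, {s : ℝ | (α - s * β) * b i - (β + s * α) * a i = 0} := by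
    ext s
    simp
  rw [hU]
  refine hF.biUnion fun i hi => Set.Subsingleton.finite fun s hs t ht => ?_
  simp only [Set.mem_ofPred_eq] at hs ht
  have hst : (s - t) * (β * b i + α * a i) = 0 := by linear_combination ht - hs
  rcases mul_eq_zero.1 hst with h1 | h1
  · linarith
  · have h2 : α * b i - β * a i = 0 := by linear_combination hs + s * h1
    exact absurd (by linear_combination (β * b i + α * a i) * h1 + (α * b i - β * a i) * h2)
      (mul_ne_zero h (hab i hi))

/-- If a Banach space `X` contains no two-dimensional Hilbert subspace, then neither does
`X ⊕_∞ c₀(I)` (realized as `X × C₀(I, ℝ)` with the max norm, `I` discrete). -/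
theorem no_hilbert_plane_in_inf_sum_with_c0
    {X : Type*} [NormedAddCommGroup X] [NormedSpace ℝ X] [CompleteSpace X]
    (I : Type*) [TopologicalSpace I] [DiscreteTopology I] [Nonempty I]
    (hX : ¬ ContainsHilbertPlane X) :
    ¬ ContainsHilbertPlane (X × C₀(I, ℝ)) := by
  rintro ⟨⟨x, a⟩, ⟨y, b⟩, h⟩
  refine hX ⟨x, y, ?_⟩
  have hmax : ∀ α β : ℝ, max ‖α • x + β • y‖ ‖α • a + β • b‖ = √(α ^ 2 + β ^ 2) := h
  have hle : ∀ i, a i ^ 2 + b i ^ 2 ≤ 1 := by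
    intro i
    have h1 : ‖(a i • a + b i • b) i‖ ≤ √(a i ^ 2 + b i ^ 2) := by
      rw [← hmax]
      refine le_max_of_le_right ?_
      rw [← ZeroAtInftyContinuousMap.norm_toBCF_eq_norm]
      exact (a i • a + b i • b).toBCF.norm_coe_le_norm i
    have h2 : (a i • a + b i • b) i = a i ^ 2 + b i ^ 2 := by simp [sq]
    rw [h2, Real.norm_of_nonneg (by positivity)] at h1
    by_contra! hlt
    have h3 := (Real.le_sqrt' (by linarith)).1 h1
    nlinarith
  set F : Set I := {i | a i ^ 2 + b i ^ 2 = 1}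
  have hF : F.Finite := by
    refine ((finite_setOf_le_abs a one_half_pos).union
      (finite_setOf_le_abs b one_half_pos)).subset fun i hi => ?_
    by_contra hn
    simp only [Set.mem_union, Set.mem_ofPred_eq, not_or, not_le] at hn
    have hi' : a i ^ 2 + b i ^ 2 = 1 := hi
    have h1 := sq_lt_sq' (by linarith [abs_nonneg (a i)]) hn.1
    have h2 := sq_lt_sq' (by linarith [abs_nonneg (b i)]) hn.2
    rw [sq_abs] at h1 h2
    linarith
  have hgood : ∀ α β : ℝ, (∀ i ∈ F, α * b i - β * a i ≠ 0) → α ^ 2 + β ^ 2 ≠ 0 →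
      ‖α • x + β • y‖ = √(α ^ 2 + β ^ 2) := by
    intro α β hn h0
    rcases max_choice ‖α • x + β • y‖ ‖α • a + β • b‖ with hm | hm
    · rw [← hm, hmax]
    · rw [hmax] at hm
      obtain ⟨i, hi⟩ := exists_norm_eq_norm_apply (α • a + β • b)
      have h1 : (α • a + β • b) i = α * a i + β * b i := by simp
      rw [← hm, h1] at hi
      have h2 : α ^ 2 + β ^ 2 = (α * a i + β * b i) ^ 2 := by
        rw [← Real.sq_sqrt (by positivity : 0 ≤ α ^ 2 + β ^ 2), hi, Real.norm_eq_abs, sq_abs]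
      have hpos : 0 < α ^ 2 + β ^ 2 := lt_of_le_of_ne (by positivity) h0.symm
      have h3 : (α ^ 2 + β ^ 2) * (1 - (a i ^ 2 + b i ^ 2)) + (α * b i - β * a i) ^ 2 = 0 := by
        linear_combination h2
      have h4 := mul_nonneg hpos.le (sub_nonneg.2 (hle i))
      have h5 : (α * b i - β * a i) ^ 2 = 0 := by nlinarith [sq_nonneg (α * b i - β * a i)]
      have h6 : 1 - (a i ^ 2 + b i ^ 2) = 0 := by
        rw [h5, add_zero] at h3
        exact (mul_eq_zero.1 h3).resolve_left h0
      exact (hn i (sub_eq_zero.1 h6).symm (pow_eq_zero_iff two_ne_zero |>.1 h5)).elim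
  intro α β
  by_cases h0 : α ^ 2 + β ^ 2 = 0
  · obtain rfl : α = 0 := by nlinarith
    obtain rfl : β = 0 := by nlinarith
    simp
  have hfin := finite_setOf_exists_parallel hF a b (fun i hi => by
    rw [show a i ^ 2 + b i ^ 2 = 1 from hi]; exact one_ne_zero) h0
  have heq : (fun s : ℝ => ‖(α - s * β) • x + (β + s * α) • y‖) =
      fun s : ℝ => √((α - s * β) ^ 2 + (β + s * α) ^ 2) := by
    refine Continuous.ext_on (hfin.countable.dense_compl ℝ) (by fun_prop) (by fun_prop) fun s hs => ?_
    refine hgood _ _ (fun i hi hz => hs ⟨i, hi, hz⟩) ?_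
    rw [show (α - s * β) ^ 2 + (β + s * α) ^ 2 = (α ^ 2 + β ^ 2) * (1 + s ^ 2) by ring]
    exact mul_ne_zero h0 (by positivity)
  simpa using congrFun heq 0
end
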